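/- For every k ≥ 1 there exists a constant c_k such that the following holds: if a finite simple graph G on n vertices is k-creature-free and does not contain the k-skinny ladder as an induced minor, then the number of minimal separators of G is at most c_k · n^{c_k · log n}. -/

import Mathlib

open SimpleGraph

/-- `S` is a `u`-`v`-separator in `G`: `u, v ∉ S` and every walk from `u` to `v` meets `S`
(i.e. `u` and `v` lie in different components of `G − S`). -/
def IsUVSeparator {V : Type*} (G : SimpleGraph V) (S : Set V) (u v : V) : Prop :=
  u ∉ S ∧ v ∉ S ∧ ∀ p : G.Walk u v, ∃ w ∈ p.support, w ∈ S

/-- `S` is an inclusion-minimal `u`-`v`-separator in `G`. -/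
def IsMinimalUVSeparator {V : Type*} (G : SimpleGraph V) (S : Set V) (u v : V) : Prop :=
  IsUVSeparator G S u v ∧ ∀ S' ⊂ S, ¬ IsUVSeparator G S' u v

/-- `S` is a minimal separator of `G`. -/
def IsMinimalSeparator {V : Type*} (G : SimpleGraph V) (S : Set V) : Prop :=
  ∃ u v, IsMinimalUVSeparator G S u v

/-- The (open) neighborhood of a set `A`: vertices outside `A` with a neighbor in `A`. -/
def nbhd {V : Type*} (G : SimpleGraph V) (A : Set V) : Set V :=
  {w | w ∉ A ∧ ∃ a ∈ A, G.Adj w a}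

/-- `(A, B, X, Y)` is a `k`-creature in `G`. -/
def IsCreature {V : Type*} (G : SimpleGraph V) (k : ℕ) (A B X Y : Set V) : Prop :=
  A.Nonempty ∧ B.Nonempty ∧ X.Nonempty ∧ Y.Nonempty ∧
  Disjoint A B ∧ Disjoint A X ∧ Disjoint A Y ∧
  Disjoint B X ∧ Disjoint B Y ∧ Disjoint X Y ∧
  (G.induce A).Connected ∧ (G.induce B).Connected ∧
  (∀ a ∈ A, ∀ w ∈ Y ∪ B, ¬ G.Adj a w) ∧
  (∀ b ∈ B, ∀ w ∈ A ∪ X, ¬ G.Adj b w) ∧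
  (∀ x ∈ X, ∃ a ∈ A, G.Adj x a) ∧
  (∀ y ∈ Y, ∃ b ∈ B, G.Adj y b) ∧
  ∃ x y : Fin k → V, Function.Injective x ∧ Function.Injective y ∧
    Set.range x = X ∧ Set.range y = Y ∧
    ∀ i j, G.Adj (x i) (y j) ↔ i = j

/-- `G` is `k`-creature-free. -/
def CreatureFree {V : Type*} (G : SimpleGraph V) (k : ℕ) : Prop :=
  ∀ A B X Y : Set V, ¬ IsCreature G k A B X Y

/-- The `k`-skinny ladder: vertices `(0, i) = pᵢ`, `(1, i) = qᵢ`, `(2, i) = rᵢ`;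
edges `pᵢpᵢ₊₁`, `qᵢqᵢ₊₁`, `pᵢrᵢ`, `qᵢrᵢ`. -/
def skinnyLadder (k : ℕ) : SimpleGraph (Fin 3 × Fin k) :=
  SimpleGraph.fromRel (fun a b =>
    (a.1 = b.1 ∧ a.1 ≠ 2 ∧ (a.2 : ℕ) + 1 = (b.2 : ℕ)) ∨
    (a.1 ≠ 2 ∧ b.1 = 2 ∧ a.2 = b.2))

/-- `H` is an induced minor of `G`: there are pairwise disjoint nonempty connected branch sets
realizing the adjacencies of `H` exactly. -/
def IsInducedMinor {W V : Type*} (H : SimpleGraph W) (G : SimpleGraph V) : Prop :=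
  ∃ B : W → Set V,
    (∀ h, (B h).Nonempty) ∧
    (∀ h, (G.induce (B h)).Connected) ∧
    (Pairwise fun h h' => Disjoint (B h) (B h')) ∧
    ∀ h h', h ≠ h' → ((∃ a ∈ B h, ∃ b ∈ B h', G.Adj a b) ↔ H.Adj h h')

/-- `ζ_G(S)`: the maximum size of an independent set `I ⊆ S` such that no vertex outside `S`
has more than one neighbor in `I`. -/
noncomputable def zeta {V : Type*} (G : SimpleGraph V) (S : Set V) : ℕ :=
  sSup {n | ∃ I : Set V, I ⊆ S ∧ (∀ a ∈ I, ∀ b ∈ I, ¬ G.Adj a b) ∧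
    (∀ v, v ∉ S → (I ∩ G.neighborSet v).ncard ≤ 1) ∧ I.ncard = n}

/-- `D` is a connected component of `G[U]`. -/
def IsCompOf {V : Type*} (G : SimpleGraph V) (U D : Set V) : Prop :=
  D ⊆ U ∧ D.Nonempty ∧ (G.induce D).Connected ∧
  ∀ a ∈ D, ∀ b ∈ U, G.Adj a b → b ∈ D


namespace GLo

/-- reachability through `W` (all vertices after the first lie in `W`). -/
def RI {V : Type} (G : SimpleGraph V) (W : Set V) (a b : V) : Prop :=
  Relation.ReflTransGen (fun x y => G.Adj x y ∧ y ∈ W) a b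

theorem RI.mono {V : Type} {G : SimpleGraph V} {W W' : Set V} (h : W ⊆ W') {a b : V}
    (hr : RI G W a b) : RI G W' a b :=
  Relation.ReflTransGen.mono (fun _ _ hxy => ⟨hxy.1, h hxy.2⟩) _ _ hr

theorem RI.mem {V : Type} {G : SimpleGraph V} {W : Set V} {a b : V}
    (hr : RI G W a b) : b = a ∨ b ∈ W := by
  rcases Relation.ReflTransGen.cases_tail hr with h | ⟨c, _, h⟩
  · exact Or.inl h
  · exact Or.inr h.2

theorem RI.mem' {V : Type} {G : SimpleGraph V} {W : Set V} {a b : V} (ha : a ∈ W)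
    (hr : RI G W a b) : b ∈ W := by
  rcases hr.mem with h | h
  · exact h ▸ ha
  · exact h

theorem RI.trans {V : Type} {G : SimpleGraph V} {W : Set V} {a b c : V}
    (h1 : RI G W a b) (h2 : RI G W b c) : RI G W a c :=
  Relation.ReflTransGen.trans h1 h2

theorem RI.tail {V : Type} {G : SimpleGraph V} {W : Set V} {a b c : V}
    (h1 : RI G W a b) (h2 : G.Adj b c) (h3 : c ∈ W) : RI G W a c :=
  Relation.ReflTransGen.tail h1 ⟨h2, h3⟩

theorem RI.refl {V : Type} {G : SimpleGraph V} {W : Set V} {a : V} : RI G W a a :=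
  Relation.ReflTransGen.refl

theorem RI.symm {V : Type} {G : SimpleGraph V} {W : Set V} {a b : V} (ha : a ∈ W)
    (h : RI G W a b) : RI G W b a := by
  induction h with
  | refl => exact RI.refl
  | tail h1 h2 ih =>
    have hb := RI.mem' ha h1
    exact RI.trans (RI.tail RI.refl h2.1.symm hb) ih

theorem RI.connected {V : Type} {G : SimpleGraph V} {W : Set V} {r : V} (hr : r ∈ W)
    (h : ∀ v ∈ W, RI G W r v) : (G.induce W).Connected := by
  have key : ∀ v, RI G W r v → ∀ hv : v ∈ W, (G.induce W).Reachable ⟨r, hr⟩ ⟨v, hv⟩ := by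
    intro v hv
    induction hv with
    | refl => intro _; exact SimpleGraph.Reachable.refl _
    | tail h1 h2 ih =>
      intro hv
      have hb := RI.mem' hr h1
      refine (ih hb).trans (SimpleGraph.Adj.reachable ?_)
      exact h2.1
  rw [SimpleGraph.connected_iff_exists_forall_reachable]
  exact ⟨⟨r, hr⟩, fun w => key w (h w w.2) w.2⟩

theorem RI.of_connected {V : Type} {G : SimpleGraph V} {W : Set V}
    (hc : (G.induce W).Connected) {a b : V} (ha : a ∈ W) (hb : b ∈ W) : RI G W a b := by
  obtain ⟨p⟩ := hc.preconnected ⟨a, ha⟩ ⟨b, hb⟩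
  have key : ∀ (x y : W), (G.induce W).Walk x y → RI G W x y := by
    intro x y p
    induction p with
    | nil => exact RI.refl
    | cons h p ih => exact RI.trans (RI.tail RI.refl h (Subtype.coe_prop _)) ih
  exact key _ _ p

theorem connected_nonempty {V : Type} {G : SimpleGraph V} {W : Set V}
    (hc : (G.induce W).Connected) : W.Nonempty := by
  obtain ⟨⟨x, hx⟩⟩ := hc.nonempty
  exact ⟨x, hx⟩

/-- component of `a` in `G[W]`. -/
def comp {V : Type} (G : SimpleGraph V) (W : Set V) (a : V) : Set V := {v | RI G W a v}

theorem RI.into_comp {V : Type} {G : SimpleGraph V} {W : Set V} {a b : V}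
    (h : RI G W a b) : RI G (comp G W a) a b := by
  induction h with
  | refl => exact RI.refl
  | tail h1 h2 ih => exact ih.tail h2.1 (RI.tail h1 h2.1 h2.2)

theorem comp_connected {V : Type} {G : SimpleGraph V} {W : Set V} {a : V} :
    (G.induce (comp G W a)).Connected :=
  RI.connected (r := a) RI.refl (fun _ hv => RI.into_comp hv)

theorem comp_subset {V : Type} {G : SimpleGraph V} {W : Set V} {a : V} (ha : a ∈ W) :
    comp G W a ⊆ W := fun _ hv => RI.mem' ha hv

theorem singleton_connected {V : Type} (G : SimpleGraph V) (a : V) :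
    (G.induce ({a} : Set V)).Connected :=
  RI.connected (r := a) rfl (fun v hv => by rw [Set.mem_singleton_iff.1 hv]; exact RI.refl)

/-- closed neighbourhood of a set -/
def nb {V : Type} (G : SimpleGraph V) (Q : Set V) : Set V := {w | ∃ q ∈ Q, w = q ∨ G.Adj q w}

theorem nb_mono {V : Type} {G : SimpleGraph V} {Q Q' : Set V} (h : Q ⊆ Q') :
    nb G Q ⊆ nb G Q' := fun _ ⟨q, hq, h'⟩ => ⟨q, h hq, h'⟩

theorem creature_mk {V : Type} {G : SimpleGraph V} {k : ℕ} (hk : 1 ≤ k) {A B : Set V}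
    (hA : (G.induce A).Connected) (hB : (G.induce B).Connected) (hAB : Disjoint A B)
    (hab : ∀ a ∈ A, ∀ b ∈ B, ¬ G.Adj a b) (x y : Fin k → V)
    (hay : ∀ a ∈ A, ∀ i, ¬ G.Adj a (y i)) (hbx : ∀ b ∈ B, ∀ i, ¬ G.Adj b (x i))
    (hxa : ∀ i, ∃ a ∈ A, G.Adj (x i) a) (hyb : ∀ i, ∃ b ∈ B, G.Adj (y i) b)
    (hxy : ∀ i j, G.Adj (x i) (y j) ↔ i = j) :
    IsCreature G k A B (Set.range x) (Set.range y) := by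
  have hne : Nonempty (Fin k) := ⟨⟨0, hk⟩⟩
  refine ⟨connected_nonempty hA, connected_nonempty hB, Set.range_nonempty x,
    Set.range_nonempty y, hAB, ?_, ?_, ?_, ?_, ?_, hA, hB, ?_, ?_, ?_, ?_, x, y, ?_, ?_, rfl, rfl,
    hxy⟩
  · rw [Set.disjoint_left]
    rintro _ ha ⟨i, rfl⟩
    exact hay _ ha i ((hxy i i).2 rfl)
  · rw [Set.disjoint_left]
    rintro _ ha ⟨i, rfl⟩
    obtain ⟨b, hb, h⟩ := hyb i
    exact hab _ ha b hb h
  · rw [Set.disjoint_left]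
    rintro _ hb ⟨i, rfl⟩
    obtain ⟨a, ha, h⟩ := hxa i
    exact hab a ha _ hb h.symm
  · rw [Set.disjoint_left]
    rintro _ hb ⟨i, rfl⟩
    exact hbx _ hb i ((hxy i i).2 rfl).symm
  · rw [Set.disjoint_left]
    rintro _ ⟨i, rfl⟩ ⟨j, hj⟩
    obtain ⟨a, ha, h⟩ := hxa i
    exact hay a ha j (by rw [hj]; exact h.symm)
  · rintro a ha w (⟨i, rfl⟩ | hw)
    · exact hay a ha i
    · exact hab a ha w hw
  · rintro b hb w (hw | ⟨i, rfl⟩)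
    · exact fun h => hab w hw b hb h.symm
    · exact hbx b hb i
  · rintro _ ⟨i, rfl⟩; exact hxa i
  · rintro _ ⟨i, rfl⟩; exact hyb i
  · intro i j hij
    have := (hxy j j).2 rfl
    rw [← hij] at this
    exact (hxy i j).1 this
  · intro i j hij
    have := (hxy i i).2 rfl
    rw [hij] at this
    exact (hxy i j).1 this

/-- weight of a set -/
noncomputable def wt {V : Type} [Fintype V] (ν : V → ℝ) (X : Set V) : ℝ := ∑ v, X.indicator ν v

theorem wt_mono {V : Type} [Fintype V] {ν : V → ℝ} (hν : ∀ v, 0 ≤ ν v) {X Y : Set V}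
    (h : X ⊆ Y) : wt ν X ≤ wt ν Y :=
  Finset.sum_le_sum fun v _ => Set.indicator_le_indicator_of_subset h (fun v => hν v) v

theorem wt_nonneg {V : Type} [Fintype V] {ν : V → ℝ} (hν : ∀ v, 0 ≤ ν v) (X : Set V) :
    0 ≤ wt ν X :=
  Finset.sum_nonneg fun v _ => Set.indicator_nonneg (fun v _ => hν v) v

theorem wt_union_disj {V : Type} [Fintype V] {ν : V → ℝ} {X Y : Set V} (h : Disjoint X Y) :
    wt ν (X ∪ Y) = wt ν X + wt ν Y := by
  unfold wt
  rw [← Finset.sum_add_distrib]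
  refine Finset.sum_congr rfl fun v _ => ?_
  rw [Set.indicator_union_of_disjoint h]

theorem wt_union_le {V : Type} [Fintype V] {ν : V → ℝ} (hν : ∀ v, 0 ≤ ν v) (X Y : Set V) :
    wt ν (X ∪ Y) ≤ wt ν X + wt ν Y := by
  rw [← Set.union_sdiff_self, wt_union_disj Set.disjoint_sdiff_right]
  have := wt_mono hν (X := Y \ X) (Y := Y) Set.sdiff_subset
  linarith

theorem wt_empty {V : Type} [Fintype V] {ν : V → ℝ} : wt ν (∅ : Set V) = 0 := by
  simp [wt]

theorem wt_biUnion_le {V ι : Type} [Fintype V] {ν : V → ℝ} (hν : ∀ v, 0 ≤ ν v) (s : Finset ι)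
    (F : ι → Set V) : wt ν (⋃ i ∈ s, F i) ≤ ∑ i ∈ s, wt ν (F i) := by
  classical
  induction s using Finset.induction_on with
  | empty => simp [wt_empty]
  | insert a s ha ih =>
    rw [Finset.sum_insert ha, Finset.set_biUnion_insert]
    exact (wt_union_le hν _ _).trans (by linarith)

/-- Full pair of components around a separator. -/
structure FullPair {V : Type} (G : SimpleGraph V) (A B S : Set V) : Prop where
  cA : (G.induce A).Connected
  cB : (G.induce B).Connected
  dAB : Disjoint A B
  dAS : Disjoint A S
  dBS : Disjoint B S
  ac : ∀ a ∈ A, ∀ b ∈ B, ¬ G.Adj a b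
  nA : ∀ s ∈ S, ∃ a ∈ A, G.Adj s a
  nB : ∀ s ∈ S, ∃ b ∈ B, G.Adj s b
  oA : ∀ a ∈ A, ∀ w, G.Adj a w → w ∈ A ∪ S
  oB : ∀ b ∈ B, ∀ w, G.Adj b w → w ∈ B ∪ S

theorem FullPair.symm {V : Type} {G : SimpleGraph V} {A B S : Set V} (h : FullPair G A B S) :
    FullPair G B A S :=
  ⟨h.cB, h.cA, h.dAB.symm, h.dBS, h.dAS, fun b hb a ha hab => h.ac a ha b hb hab.symm, h.nB, h.nA,
    h.oB, h.oA⟩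

theorem FullPair.nbhd_eq {V : Type} {G : SimpleGraph V} {A B S : Set V} (h : FullPair G A B S) :
    nbhd G A = S := by
  ext w
  constructor
  · rintro ⟨hw, a, ha, hwa⟩
    rcases h.oA a ha w hwa.symm with h' | h'
    · exact absurd h' hw
    · exact h'
  · intro hw
    exact ⟨fun hA => Set.disjoint_left.1 h.dAS hA hw, h.nA w hw⟩

theorem RI.walk {V : Type} {G : SimpleGraph V} {W : Set V} {a b : V} (ha : a ∈ W)
    (h : RI G W a b) : ∃ p : G.Walk a b, ∀ w ∈ p.support, w ∈ W := by
  induction h with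
  | refl => exact ⟨SimpleGraph.Walk.nil, by simpa using ha⟩
  | tail h1 h2 ih =>
    obtain ⟨p, hp⟩ := ih
    refine ⟨p.concat h2.1, fun w hw => ?_⟩
    rw [SimpleGraph.Walk.support_concat] at hw
    simp only [List.mem_append, List.mem_singleton] at hw
    rcases hw with hw | rfl
    · exact hp w hw
    · exact h2.2

theorem RI.of_walk {V : Type} {G : SimpleGraph V} {W : Set V} {a b : V} (p : G.Walk a b)
    (hp : ∀ w ∈ p.support, w ∈ W) : RI G W a b := by
  induction p with
  | nil => exact RI.refl
  | cons h p ih =>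
    refine RI.trans (RI.tail RI.refl h (hp _ ?_)) (ih fun w hw => hp w ?_)
    · simp
    · simp [hw]

theorem sep_half {V : Type} {G : SimpleGraph V} {S : Set V} {u v : V}
    (hu : u ∉ S) (hmin : ∀ S' ⊂ S, ∃ p : G.Walk u v, ∀ w ∈ p.support, w ∉ S')
    (hsep : ¬ RI G Sᶜ u v) (s : V) (hs : s ∈ S) :
    ∃ a ∈ comp G Sᶜ u, G.Adj s a := by
  obtain ⟨p, hp⟩ := hmin (S \ {s}) ⟨Set.sdiff_subset, fun h => (h hs).2 rfl⟩
  have hri : RI G (S \ {s})ᶜ u v := RI.of_walk p hp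
  by_contra hcon
  push Not at hcon
  have key : ∀ w, RI G (S \ {s})ᶜ u w → RI G Sᶜ u w := by
    intro w hw
    induction hw with
    | refl => exact RI.refl
    | @tail b c h1 h2 ih =>
      refine RI.tail ih h2.1 fun hc => ?_
      have hcs : c = s := by
        by_contra hne
        exact h2.2 ⟨hc, hne⟩
      subst hcs
      exact hcon b ih h2.1.symm
  exact hsep (key v hri)

theorem FullPair.of_sep {V : Type} {G : SimpleGraph V} {S : Set V}
    (h : IsMinimalSeparator G S) : ∃ A B, FullPair G A B S := by
  obtain ⟨u, v, ⟨hu, hv, hw⟩, hmin⟩ := h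
  have hsep : ¬ RI G Sᶜ u v := by
    intro hr
    obtain ⟨p, hp⟩ := RI.walk hu hr
    obtain ⟨w, hw1, hw2⟩ := hw p
    exact hp w hw1 hw2
  have hmin1 : ∀ S' ⊂ S, ∃ p : G.Walk u v, ∀ w ∈ p.support, w ∉ S' := by
    intro S' hS'
    have := hmin S' hS'
    unfold IsUVSeparator at this
    push Not at this
    exact this (fun h => hu (hS'.1 h)) (fun h => hv (hS'.1 h))
  have hmin2 : ∀ S' ⊂ S, ∃ p : G.Walk v u, ∀ w ∈ p.support, w ∉ S' := by
    intro S' hS'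
    obtain ⟨p, hp⟩ := hmin1 S' hS'
    exact ⟨p.reverse, by simpa using hp⟩
  have hout : ∀ x : V, ∀ a ∈ comp G Sᶜ x, ∀ w, G.Adj a w → w ∈ comp G Sᶜ x ∪ S := by
    intro x a ha w haw
    by_cases hwS : w ∈ S
    · exact Or.inr hwS
    · exact Or.inl (RI.tail ha haw hwS)
  have hd : Disjoint (comp G Sᶜ u) (comp G Sᶜ v) := by
    rw [Set.disjoint_left]
    intro x hx hy
    exact hsep (RI.trans hx (RI.symm hv hy))
  refine ⟨comp G Sᶜ u, comp G Sᶜ v, comp_connected, comp_connected, hd, ?_, ?_, ?_, ?_, ?_,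
    hout u, hout v⟩
  · rw [Set.disjoint_left]
    exact fun x hx => comp_subset hu hx
  · rw [Set.disjoint_left]
    exact fun x hx => comp_subset hv hx
  · intro a ha b hb hab
    exact Set.disjoint_left.1 hd (RI.tail ha hab (comp_subset (G := G) hv hb)) hb
  · exact sep_half hu hmin1 hsep
  · exact sep_half hv hmin2 fun h => hsep (RI.symm hv h)

end GLo
namespace GLo

theorem exists_closer {W : Type} {H : SimpleGraph W} (hc : H.Connected) (r v : W) (hv : v ≠ r) :
    ∃ u, H.Adj v u ∧ H.dist r u + 1 = H.dist r v := by
  obtain ⟨p, hp⟩ := hc.exists_walk_length_eq_dist v r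
  cases p with
  | nil => exact absurd rfl hv
  | cons h p =>
    rename_i u
    refine ⟨u, h, ?_⟩
    rw [SimpleGraph.Walk.length_cons] at hp
    have h1 : H.dist u r ≤ p.length := SimpleGraph.dist_le p
    have h2 : H.dist v r ≤ H.dist v u + H.dist u r := hc.dist_triangle
    have h3 : H.dist v u = 1 := SimpleGraph.dist_eq_one_iff_adj.2 h
    rw [SimpleGraph.dist_comm (u := r), SimpleGraph.dist_comm (u := r)]
    omega

/-- dist-decreasing parent function. -/
theorem exists_parent {W : Type} {H : SimpleGraph W} (hc : H.Connected) (r : W) :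
    ∃ par : W → W, par r = r ∧ ∀ v, v ≠ r → H.Adj v (par v) ∧ H.dist r (par v) + 1 = H.dist r v := by
  classical
  choose f hf using exists_closer hc r
  refine ⟨fun v => if h : v = r then r else f v h, by simp, fun v hv => ?_⟩
  simp only [hv, dite_false]
  exact hf v hv

theorem lemP {V : Type} [Fintype V] {G : SimpleGraph V} {k : ℕ} (hk : 1 ≤ k)
    (cf : CreatureFree G k) {A0 B0 T : Set V} (cA : (G.induce A0).Connected)
    (cB : (G.induce B0).Connected) (dAB : Disjoint A0 B0)
    (ac : ∀ a ∈ A0, ∀ b ∈ B0, ¬ G.Adj a b) (tA : ∀ t ∈ T, ∃ a ∈ A0, G.Adj t a)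
    (tB : ∀ t ∈ T, ∃ b ∈ B0, G.Adj t b) (ν : V → ℝ) (hν : ∀ v, 0 ≤ ν v) :
    ∃ (p : ℕ → V) (l : ℕ), (∀ i ≤ l, p i ∈ A0) ∧ (∀ i ≤ l, ∀ j ≤ l, p i = p j → i = j) ∧
      (∀ i ≤ l, ∀ j ≤ l, G.Adj (p i) (p j) ↔ (i + 1 = j ∨ j + 1 = i)) ∧
      wt ν T ≤ k * wt ν {t ∈ T | ∃ i ≤ l, G.Adj t (p i)} := by
  classical
  obtain ⟨A, hAA0, hAmin⟩ := Set.Finite.exists_le_minimal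
    (s := {A : Set V | (G.induce A).Connected ∧ ∀ t ∈ T, ∃ a ∈ A, G.Adj t a})
    (Set.toFinite _) (a := A0) ⟨cA, tA⟩
  obtain ⟨⟨hAc, hAd⟩, hAm⟩ := hAmin
  have hAA0 : A ⊆ A0 := hAA0
  obtain ⟨r⟩ := hAc.nonempty
  set H := G.induce A with hH
  obtain ⟨par, par_r, hpar⟩ := exists_parent hAc r
  set d : A → ℕ := fun v => H.dist r v with hd
  let Λ : Finset A := Finset.univ.filter fun v => v ≠ r ∧ ∀ u, par u ≠ v
  have hΛ : ∀ v, v ∈ Λ ↔ v ≠ r ∧ ∀ u, par u ≠ v := fun v => by simp [Λ]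
  -- removal of subset of leaves
  have hrem : ∀ M : Finset A, M ⊆ Λ →
      (G.induce {v | ∃ h : v ∈ A, (⟨v, h⟩ : A) ∉ M}).Connected := by
    intro M hM
    have hrM : r ∉ M := fun h => ((hΛ r).1 (hM h)).1 rfl
    have key : ∀ n, ∀ v : A, d v = n → v ∉ M →
        RI G {v | ∃ h : v ∈ A, (⟨v, h⟩ : A) ∉ M} (r : V) (v : V) := by
      intro n
      induction n with
      | zero =>
        intro v hv _
        have : r = v := (hAc.dist_eq_zero_iff).1 hv
        rw [this]; exact RI.refl
      | succ n ih =>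
        intro v hv hvM
        have hvr : v ≠ r := by
          rintro rfl
          simp [hd] at hv
        obtain ⟨h1, h2⟩ := hpar v hvr
        have h3 : par v ∉ M := fun h => ((hΛ _).1 (hM h)).2 v rfl
        have h4 := ih (par v) (by simp only [hd] at hv ⊢; omega) h3
        have h5 : G.Adj (par v : V) (v : V) := h1.symm
        exact h4.tail h5 ⟨v.2, hvM⟩
    refine RI.connected (r := (r : V)) ⟨r.2, hrM⟩ ?_
    rintro v ⟨hv, hvM⟩
    exact key _ ⟨v, hv⟩ rfl hvM
  by_cases hcard : k ≤ Λ.card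
  · -- creature
    exfalso
    obtain ⟨M, hML, hMk⟩ := Finset.exists_subset_card_eq hcard
    have hpriv : ∀ x ∈ Λ, ∃ t ∈ T, ∀ a : A, G.Adj t a ↔ a = x := by
      intro x hx
      have hc := hrem {x} (by simpa using hx)
      have hnd : ¬ ∀ t ∈ T, ∃ a ∈ {v | ∃ h : v ∈ A, (⟨v, h⟩ : A) ∉ ({x} : Finset A)}, G.Adj t a := by
        intro hdom
        have := hAm ⟨hc, hdom⟩ (by rintro v ⟨h, _⟩; exact h)
        obtain ⟨h1, h2⟩ := this x.2
        simp at h2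
      push Not at hnd
      obtain ⟨t, ht, hta⟩ := hnd
      have huniq : ∀ a : A, G.Adj t a → a = x := by
        intro a hadj
        by_contra hne
        exact hta a ⟨a.2, by simpa using hne⟩ hadj
      obtain ⟨a, ha, hadj⟩ := hAd t ht
      refine ⟨t, ht, fun b => ⟨huniq b, ?_⟩⟩
      rintro rfl
      rw [← huniq ⟨a, ha⟩ hadj]; exact hadj
    haveI : Nonempty V := ⟨r⟩
    choose! tt htT htt using hpriv
    let e := (M.equivFin.trans (finCongr hMk)).symm
    have heΛ : ∀ i, ((e i : A)) ∈ Λ := fun i => hML (e i).2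
    refine cf _ _ _ _ (creature_mk hk (hrem Λ (Finset.Subset.refl _)) cB ?_ ?_
      (fun i => ((e i : A) : V)) (fun i => tt (e i)) ?_ ?_ ?_ ?_ ?_)
    · exact dAB.mono_left (by rintro v ⟨h, _⟩; exact hAA0 h)
    · rintro a ⟨ha, _⟩; exact ac a (hAA0 ha)
    · rintro a ⟨ha, haΛ⟩ i hadj
      have := (htt _ (heΛ i) ⟨a, ha⟩).1 hadj.symm
      exact haΛ (this ▸ heΛ i)
    · intro b hb i hadj
      exact ac _ (hAA0 (e i : A).2) b hb hadj.symm
    · intro i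
      have hne := ((hΛ _).1 (heΛ i)).1
      refine ⟨par (e i), ⟨(par (e i)).2, fun h => ((hΛ _).1 h).2 _ rfl⟩, (hpar _ hne).1⟩
    · intro i
      exact tB _ (htT _ (heΛ i))
    · intro i j
      rw [SimpleGraph.adj_comm, htt _ (heΛ j)]
      constructor
      · intro h
        exact e.injective (Subtype.ext h)
      · rintro rfl; rfl
  · push Not at hcard
    -- chains
    have hdit : ∀ x : A, ∀ i, i ≤ d x → d (par^[i] x) + i = d x := by
      intro x i
      induction i with
      | zero => intro _; simp
      | succ i ih =>
        intro hi
        have h1 := ih (by omega)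
        rw [Function.iterate_succ_apply']
        have hne : par^[i] x ≠ r := by
          intro h
          rw [h] at h1
          simp only [hd, SimpleGraph.dist_self] at h1 hi
          omega
        have := (hpar _ hne).2
        simp only [hd] at this h1 ⊢
        omega
    have hcover : ∀ v : A, ∃ x ∈ insert r Λ, ∃ i ≤ d x, par^[i] x = v := by
      intro v
      obtain ⟨x, hx, hxm⟩ := Finset.exists_max_image
        (Finset.univ.filter fun x : A => ∃ i ≤ d x, par^[i] x = v) d
        ⟨v, by simp only [Finset.mem_filter, Finset.mem_univ, true_and]; exact ⟨0, by omega, rfl⟩⟩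
      simp only [Finset.mem_filter, Finset.mem_univ, true_and] at hx hxm
      refine ⟨x, ?_, hx⟩
      by_contra hne
      simp only [Finset.mem_insert, not_or, hΛ, not_and] at hne
      obtain ⟨hxr, h2⟩ := hne
      have h2 := h2 hxr
      push Not at h2
      obtain ⟨u, hu⟩ := h2
      have hur : u ≠ r := by
        rintro rfl
        exact hxr (hu ▸ par_r)
      have h3 := (hpar u hur).2
      rw [hu] at h3
      obtain ⟨i, hi, hiv⟩ := hx
      have := hxm u ⟨i + 1, by simp only [hd] at hi ⊢; omega, by
        rw [Function.iterate_succ_apply, hu, hiv]⟩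
      simp only [hd] at this
      omega
    let F : A → Set V := fun x => {t ∈ T | ∃ i ≤ d x, G.Adj t (par^[i] x : A)}
    obtain ⟨x, hx, hxm⟩ := Finset.exists_max_image (insert r Λ) (fun x => wt ν (F x))
      ⟨r, Finset.mem_insert_self _ _⟩
    refine ⟨fun i => (par^[i] x : A), d x, fun i _ => hAA0 (par^[i] x).2, ?_, ?_, ?_⟩
    · intro i hi j hj hij
      have h1 := hdit x i hi
      have h2 := hdit x j hj
      rw [Subtype.ext hij] at h1
      omega
    · intro i hi j hj
      constructor
      · intro hadj
        have hadj' : H.Adj (par^[i] x) (par^[j] x) := hadj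
        have h1 := hdit x i hi
        have h2 := hdit x j hj
        have h3 : d (par^[i] x) ≤ d (par^[j] x) + 1 := by
          have := hAc.dist_triangle (u := r) (v := par^[j] x) (w := par^[i] x)
          rw [SimpleGraph.dist_eq_one_iff_adj.2 hadj'.symm] at this
          exact this
        have h4 : d (par^[j] x) ≤ d (par^[i] x) + 1 := by
          have := hAc.dist_triangle (u := r) (v := par^[i] x) (w := par^[j] x)
          rw [SimpleGraph.dist_eq_one_iff_adj.2 hadj'] at this
          exact this
        have h5 : i ≠ j := by
          rintro rfl
          exact hadj'.ne rfl
        omega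
      · have key : ∀ i, i + 1 ≤ d x → G.Adj (par^[i] x : A) (par^[i+1] x : A) := by
          intro i hi
          have h1 := hdit x i (by omega)
          rw [Function.iterate_succ_apply']
          have hne : par^[i] x ≠ r := by
            intro h
            rw [h] at h1
            simp only [hd, SimpleGraph.dist_self] at h1 hi
            omega
          exact (hpar _ hne).1
        rintro (rfl | rfl)
        · exact key i hj
        · exact (key j hi).symm
    · have h1 : wt ν T ≤ wt ν (⋃ y ∈ insert r Λ, F y) := by
        refine wt_mono hν fun t ht => ?_
        obtain ⟨a, ha, hta⟩ := hAd t ht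
        obtain ⟨y, hy, i, hi, hiy⟩ := hcover ⟨a, ha⟩
        simp only [Set.mem_iUnion]
        exact ⟨y, hy, ht, i, hi, by rw [hiy]; exact hta⟩
      have h2 := wt_biUnion_le hν (insert r Λ) F
      have h3 := Finset.sum_le_card_nsmul (insert r Λ) (fun y => wt ν (F y)) (wt ν (F x)) hxm
      have h4 : ((insert r Λ).card : ℝ) ≤ k := by
        have := Finset.card_insert_le r Λ
        exact_mod_cast (by omega : (insert r Λ).card ≤ k)
      rw [nsmul_eq_mul] at h3
      have h5 := mul_le_mul_of_nonneg_right h4 (wt_nonneg hν (F x))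
      exact h1.trans (h2.trans (h3.trans h5))

end GLo
namespace GLo

/-- `c` selects an increasing sequence of length `t` below `N`. -/
def Sel (t N : ℕ) (c : ℕ → ℕ) : Prop := (∀ i j, i < j → j < t → c i < c j) ∧ ∀ i, i < t → c i < N

theorem ramsey_aux (n : ℕ) : ∀ a b : ℕ, a + b = n → ∃ N : ℕ, ∀ (r : ℕ → ℕ → Prop) (S : Finset ℕ),
    N ≤ S.card →
    (∃ T ⊆ S, T.card = a ∧ ∀ x ∈ T, ∀ y ∈ T, x < y → r x y) ∨
    (∃ T ⊆ S, T.card = b ∧ ∀ x ∈ T, ∀ y ∈ T, x < y → ¬ r x y) := by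
  classical
  induction n with
  | zero =>
    intro a b hab
    refine ⟨0, fun r S _ => Or.inl ⟨∅, by simp, by simp; omega, by simp⟩⟩
  | succ n ih =>
    intro a b hab
    rcases Nat.eq_zero_or_pos a with rfl | ha
    · exact ⟨0, fun r S _ => Or.inl ⟨∅, by simp, by simp, by simp⟩⟩
    rcases Nat.eq_zero_or_pos b with rfl | hb
    · exact ⟨0, fun r S _ => Or.inr ⟨∅, by simp, by simp, by simp⟩⟩
    obtain ⟨a, rfl⟩ : ∃ a', a = a' + 1 := ⟨a - 1, by omega⟩
    obtain ⟨b, rfl⟩ : ∃ b', b = b' + 1 := ⟨b - 1, by omega⟩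
    obtain ⟨N1, h1⟩ := ih a (b + 1) (by omega)
    obtain ⟨N2, h2⟩ := ih (a + 1) b (by omega)
    refine ⟨N1 + N2 + 1, fun r S hS => ?_⟩
    have hne : S.Nonempty := Finset.card_pos.1 (by omega)
    set m := S.min' hne with hm
    have hmS : m ∈ S := Finset.min'_mem _ _
    have hlt : ∀ x ∈ S.erase m, m < x := fun x hx =>
      lt_of_le_of_ne (Finset.min'_le _ _ (Finset.mem_of_mem_erase hx))
        (Finset.ne_of_mem_erase hx).symm
    have hc : N1 + N2 ≤ (S.erase m).card := by rw [Finset.card_erase_of_mem hmS]; omega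
    have hsplit := Finset.card_filter_add_card_filter_not (s := S.erase m) (fun x => r m x)
    by_cases hcase : N1 ≤ ((S.erase m).filter (fun x => r m x)).card
    · rcases h1 r _ hcase with ⟨T, hTS, hTc, hT⟩ | ⟨T, hTS, hTc, hT⟩
      · left
        have hmT : m ∉ T := fun h => by
          have := hTS h
          simp at this
        refine ⟨insert m T, ?_, ?_, ?_⟩
        · intro x hx
          rcases Finset.mem_insert.1 hx with rfl | hx
          · exact hmS
          · exact Finset.mem_of_mem_erase (Finset.mem_of_mem_filter _ (hTS hx))
        · rw [Finset.card_insert_of_notMem hmT, hTc]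
        · intro x hx y hy hxy
          rcases Finset.mem_insert.1 hx with rfl | hx
          · rcases Finset.mem_insert.1 hy with rfl | hy
            · omega
            · exact (Finset.mem_filter.1 (hTS hy)).2
          · rcases Finset.mem_insert.1 hy with rfl | hy
            · have := hlt x (Finset.mem_of_mem_filter _ (hTS hx))
              omega
            · exact hT x hx y hy hxy
      · right
        exact ⟨T, hTS.trans ((Finset.filter_subset _ _).trans (Finset.erase_subset _ _)), hTc, hT⟩
    · have hcase2 : N2 ≤ ((S.erase m).filter (fun x => ¬ r m x)).card := by omega
      rcases h2 r _ hcase2 with ⟨T, hTS, hTc, hT⟩ | ⟨T, hTS, hTc, hT⟩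
      · left
        exact ⟨T, hTS.trans ((Finset.filter_subset _ _).trans (Finset.erase_subset _ _)), hTc, hT⟩
      · right
        have hmT : m ∉ T := fun h => by
          have := hTS h
          simp at this
        refine ⟨insert m T, ?_, ?_, ?_⟩
        · intro x hx
          rcases Finset.mem_insert.1 hx with rfl | hx
          · exact hmS
          · exact Finset.mem_of_mem_erase (Finset.mem_of_mem_filter _ (hTS hx))
        · rw [Finset.card_insert_of_notMem hmT, hTc]
        · intro x hx y hy hxy
          rcases Finset.mem_insert.1 hx with rfl | hx
          · rcases Finset.mem_insert.1 hy with rfl | hy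
            · omega
            · exact (Finset.mem_filter.1 (hTS hy)).2
          · rcases Finset.mem_insert.1 hy with rfl | hy
            · have := hlt x (Finset.mem_of_mem_filter _ (hTS hx))
              omega
            · exact hT x hx y hy hxy

theorem sel_of_finset (T : Finset ℕ) {t N : ℕ} (hT : T.card = t) (hN : ∀ x ∈ T, x < N) :
    ∃ c, Sel t N c ∧ ∀ i < t, c i ∈ T := by
  refine ⟨fun i => if h : i < t then T.orderEmbOfFin hT ⟨i, h⟩ else 0, ⟨?_, ?_⟩, ?_⟩
  · intro i j hij hj
    simp only [hj, hij.trans hj, dite_true]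
    exact (T.orderEmbOfFin hT).strictMono hij
  · intro i hi
    simp only [hi, dite_true]
    exact hN _ (Finset.orderEmbOfFin_mem _ _ _)
  · intro i hi
    simp only [hi, dite_true]
    exact Finset.orderEmbOfFin_mem _ _ _

theorem ramsey (t : ℕ) : ∃ N : ℕ, ∀ r : ℕ → ℕ → Prop, ∃ c, Sel t N c ∧
    ((∀ i j, i < j → j < t → r (c i) (c j)) ∨ (∀ i j, i < j → j < t → ¬ r (c i) (c j))) := by
  obtain ⟨N, hN⟩ := ramsey_aux (t + t) t t rfl
  refine ⟨N, fun r => ?_⟩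
  rcases hN r (Finset.range N) (by simp) with ⟨T, hTS, hTc, hT⟩ | ⟨T, hTS, hTc, hT⟩
  · obtain ⟨c, hc, hcT⟩ := sel_of_finset T hTc (fun x hx => Finset.mem_range.1 (hTS hx))
    exact ⟨c, hc, Or.inl fun i j hij hj =>
      hT _ (hcT i (hij.trans hj)) _ (hcT j hj) (hc.1 i j hij hj)⟩
  · obtain ⟨c, hc, hcT⟩ := sel_of_finset T hTc (fun x hx => Finset.mem_range.1 (hTS hx))
    exact ⟨c, hc, Or.inr fun i j hij hj =>
      hT _ (hcT i (hij.trans hj)) _ (hcT j hj) (hc.1 i j hij hj)⟩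

theorem Sel.comp {t N M : ℕ} {c d : ℕ → ℕ} (hc : Sel t N c) (hd : Sel N M d) :
    Sel t M (fun i => d (c i)) :=
  ⟨fun i j hij hj => hd.1 _ _ (hc.1 i j hij hj) (hc.2 j hj), fun i hi => hd.2 _ (hc.2 i hi)⟩

theorem Sel.inj {t N : ℕ} {c : ℕ → ℕ} (hc : Sel t N c) {i j : ℕ} (hi : i < t) (hj : j < t)
    (h : c i = c j) : i = j := by
  rcases lt_trichotomy i j with h1 | h1 | h1
  · have := hc.1 i j h1 hj; omega
  · exact h1
  · have := hc.1 j i h1 hi; omega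

/-- Pair `i, j` alternates: `K` ordered disjoint intervals each containing occurrences of both. -/
def Alt (K : ℕ) (O O' : Set ℕ) : Prop :=
  ∃ l r : ℕ → ℕ, (∀ h, h + 1 < K → r h < l (h + 1)) ∧
    ∀ h < K, (∃ x ∈ O, l h ≤ x ∧ x ≤ r h) ∧ (∃ x ∈ O', l h ≤ x ∧ x ≤ r h)

theorem lemW (K t : ℕ) : ∃ N : ℕ, ∀ (e : ℕ → ℕ) (occ : ℕ → Set ℕ),
    (∀ i j, i < j → j < N → e i < e j) → (∀ i < N, e i ∈ occ i) →
    (∀ i < N, ∀ j < N, i ≠ j → ¬ Alt K (occ i) (occ j)) →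
    ∃ c, Sel t N c ∧ ∀ i j, i < j → j < t → ∀ x ∈ occ (c i), e (c j) ≤ x → e (c (t - 1)) < x := by
  suffices H : ∃ N : ℕ, 1 ≤ N ∧ ∀ (e : ℕ → ℕ) (occ : ℕ → Set ℕ),
    (∀ i j, i < j → j < N → e i < e j) → (∀ i < N, e i ∈ occ i) →
    (∀ i < N, ∀ j < N, i ≠ j → ¬ Alt K (occ i) (occ j)) →
    ∃ c, Sel t N c ∧ ∀ i j, i < j → j < t → ∀ x ∈ occ (c i), e (c j) ≤ x → e (c (t - 1)) < x by
    obtain ⟨N, _, h⟩ := H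
    exact ⟨N, h⟩
  induction t with
  | zero => exact ⟨1, le_rfl, fun e occ _ _ _ => ⟨id, ⟨by simp, by simp⟩, by simp⟩⟩
  | succ t ih =>
    obtain ⟨N, hN1, hN⟩ := ih
    refine ⟨2 + K * N, by omega, fun e occ he hocc halt => ?_⟩
    have hidx : ∀ γ < K, ∀ i < N, 2 + γ * N + i < 2 + K * N := by
      intro γ hγ i hi
      have : (γ + 1) * N ≤ K * N := Nat.mul_le_mul_right N hγ
      have h2 : (γ + 1) * N = γ * N + N := by ring
      omega
    -- some letter z < 2 misses some group
    have hmiss : ∃ z < 2, ∃ γ < K, ∀ x ∈ occ z, e (2 + γ * N) ≤ x → e (2 + γ * N + (N - 1)) < x := by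
      by_contra hcon
      push Not at hcon
      refine halt 0 (by omega) 1 (by omega) (by omega) ⟨fun γ => e (2 + γ * N),
        fun γ => e (2 + γ * N + (N - 1)), ?_, ?_⟩
      · intro h hh
        apply he
        · have h2 : (h + 1) * N = h * N + N := by ring
          omega
        · have := hidx (h + 1) hh 0 (by omega)
          omega
      · intro h hh
        exact ⟨hcon 0 (by omega) h hh, hcon 1 (by omega) h hh⟩
    obtain ⟨z, hz, γ, hγ, hzx⟩ := hmiss
    obtain ⟨c, hc, hcg⟩ := hN (fun i => e (2 + γ * N + i)) (fun i => occ (2 + γ * N + i))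
      (fun i j hij hj => he _ _ (by omega) (hidx γ hγ j hj))
      (fun i hi => hocc _ (hidx γ hγ i hi))
      (fun i hi j hj hij => halt _ (hidx γ hγ i hi) _ (hidx γ hγ j hj) (by omega))
    have hemono : ∀ i j, i ≤ j → j < 2 + K * N → e i ≤ e j := by
      intro i j hij hj
      rcases Nat.eq_or_lt_of_le hij with rfl | h
      · exact le_rfl
      · exact (he i j h hj).le
    refine ⟨fun i => if i = 0 then z else 2 + γ * N + c (i - 1), ⟨?_, ?_⟩, ?_⟩
    · intro i j hij hj
      have hj0 : j ≠ 0 := by omega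
      simp only [hj0, if_false]
      split_ifs with h
      · omega
      · have := hc.1 (i - 1) (j - 1) (by omega) (by omega)
        omega
    · intro i hi
      dsimp only
      split_ifs with h
      · omega
      · exact hidx γ hγ _ (hc.2 _ (by omega))
    · intro i j hij hj x
      have hj0 : j ≠ 0 := by omega
      have ht0 : t ≠ 0 := by omega
      simp only [hj0, if_false, Nat.add_sub_cancel, ht0]
      split_ifs with h
      · intro hx hjx
        have h1 := hc.2 (j - 1) (by omega)
        have h2 := hc.2 (t - 1) (by omega)
        have h3 := hemono (2 + γ * N) (2 + γ * N + c (j - 1)) (by omega) (hidx γ hγ _ h1)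
        have h4 := hzx x hx (by omega)
        have h5 := hemono (2 + γ * N + c (t - 1)) (2 + γ * N + (N - 1)) (by omega)
          (hidx γ hγ _ (by omega))
        omega
      · intro hx hjx
        exact hcg (i - 1) (j - 1) (by omega) (by omega) x hx hjx

theorem sampling {V : Type} [Fintype V] (ν : V → ℝ) (hν : ∀ v, 0 ≤ ν v) (T : Set V)
    (D : V → V → V → Prop) (η : ℝ) (L : ℕ)
    (hD : ∀ s ∈ T, ∀ t ∈ T, wt ν {r ∈ T | D s t r} ≤ η * wt ν T)
    (hη : (L : ℝ) ^ 3 * η < 1) (hT : 0 < wt ν T) :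
    ∃ f : Fin L → V, (∀ i, f i ∈ T) ∧ ∀ i j l, l ≠ i → l ≠ j → ¬ D (f i) (f j) (f l) := by
  classical
  rcases L with _ | n
  · exact ⟨Fin.elim0, fun i => i.elim0, fun i => i.elim0⟩
  by_contra hcon
  push Not at hcon
  set μ : V → ℝ := T.indicator ν with hμ
  have hμ0 : ∀ v, 0 ≤ μ v := fun v => Set.indicator_nonneg (fun v _ => hν v) v
  set w := wt ν T with hw
  have hwμ : ∑ v, μ v = w := rfl
  have htot : w ^ (n + 1) = ∑ f : Fin (n + 1) → V, ∏ i, μ (f i) := by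
    rw [← hwμ, Fintype.sum_pow]
  -- the bad event weights
  have hbad : ∀ i j l : Fin (n + 1), l ≠ i → l ≠ j →
      ∑ f : Fin (n + 1) → V, (if D (f i) (f j) (f l) then ∏ m, μ (f m) else 0)
        ≤ η * w ^ (n + 1) := by
    intro i j l hi hj
    obtain ⟨i', rfl⟩ := Fin.exists_succAbove_eq hi.symm
    obtain ⟨j', rfl⟩ := Fin.exists_succAbove_eq hj.symm
    rw [← (Fin.insertNthEquiv (fun _ => V) l).sum_comp, Fintype.sum_prod_type_right]
    have hrow : ∀ g : Fin n → V, ∑ v : V, (if D (g i') (g j') v then μ v * ∏ m, μ (g m) else 0)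
        ≤ η * w * ∏ m, μ (g m) := by
      intro g
      by_cases hg : g i' ∈ T ∧ g j' ∈ T
      · have h1 := hD _ hg.1 _ hg.2
        have h2 : ∑ v : V, (if D (g i') (g j') v then μ v * ∏ m, μ (g m) else 0) =
            wt ν {r ∈ T | D (g i') (g j') r} * ∏ m, μ (g m) := by
          unfold wt
          rw [Finset.sum_mul]
          refine Finset.sum_congr rfl fun v _ => ?_
          by_cases hv : D (g i') (g j') v
          · simp [hv, hμ, Set.indicator_apply]
          · simp [hv]
        rw [h2]
        exact mul_le_mul_of_nonneg_right h1 (Finset.prod_nonneg fun m _ => hμ0 _)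
      · have h0 : ∏ m, μ (g m) = 0 := by
          by_cases h : g i' ∈ T
          · refine Finset.prod_eq_zero (Finset.mem_univ j') ?_
            exact Set.indicator_of_notMem (fun h' => hg ⟨h, h'⟩) _
          · exact Finset.prod_eq_zero (Finset.mem_univ i') (Set.indicator_of_notMem h _)
        simp [h0]
    calc _ = ∑ g : Fin n → V, ∑ v : V,
          (if D (g i') (g j') v then μ v * ∏ m, μ (g m) else 0) := by
          refine Finset.sum_congr rfl fun g _ => Finset.sum_congr rfl fun v _ => ?_
          simp only [Fin.insertNthEquiv_apply, Fin.insertNth_apply_succAbove,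
            Fin.insertNth_apply_same]
          rw [Fin.prod_univ_succAbove _ l]
          simp
      _ ≤ ∑ g : Fin n → V, η * w * ∏ m, μ (g m) := Finset.sum_le_sum fun g _ => hrow g
      _ = η * w * w ^ n := by rw [← Finset.mul_sum, ← hwμ, Fintype.sum_pow]
      _ = η * w ^ (n + 1) := by ring
  have hη0 : 0 ≤ η := by
    by_contra h
    push Not at h
    obtain ⟨t, ht⟩ : T.Nonempty := by
      by_contra h
      rw [Set.not_nonempty_iff_eq_empty] at h
      rw [hw, h, wt_empty] at hT
      exact lt_irrefl _ hT
    have h1 := hD t ht t ht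
    have h2 := wt_nonneg hν {r ∈ T | D t t r}
    nlinarith
  have hle : w ^ (n + 1) ≤ ∑ i : Fin (n + 1), ∑ j : Fin (n + 1), ∑ l : Fin (n + 1),
      ∑ f : Fin (n + 1) → V,
        (if l ≠ i ∧ l ≠ j ∧ D (f i) (f j) (f l) then ∏ m, μ (f m) else 0) := by
    have hsw : (∑ i : Fin (n + 1), ∑ j : Fin (n + 1), ∑ l : Fin (n + 1),
      ∑ f : Fin (n + 1) → V,
        (if l ≠ i ∧ l ≠ j ∧ D (f i) (f j) (f l) then ∏ m, μ (f m) else 0)) =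
        ∑ f : Fin (n + 1) → V, ∑ x : Fin (n + 1) × Fin (n + 1) × Fin (n + 1),
        (if x.2.2 ≠ x.1 ∧ x.2.2 ≠ x.2.1 ∧ D (f x.1) (f x.2.1) (f x.2.2)
          then ∏ m, μ (f m) else 0) := by
      symm
      rw [Finset.sum_comm]
      simp only [Fintype.sum_prod_type]
    rw [hsw, htot]
    refine Finset.sum_le_sum fun f _ => ?_
    have hpn : 0 ≤ ∏ m, μ (f m) := Finset.prod_nonneg fun m _ => hμ0 _
    by_cases hf : ∀ i, f i ∈ T
    · obtain ⟨i, j, l, h1, h2, h3⟩ := hcon f hf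
      refine le_trans ?_ (Finset.single_le_sum (f := fun x : Fin (n + 1) × Fin (n + 1) × Fin (n + 1)
        => if x.2.2 ≠ x.1 ∧ x.2.2 ≠ x.2.1 ∧ D (f x.1) (f x.2.1) (f x.2.2)
          then ∏ m, μ (f m) else 0) (fun x _ => ?_) (Finset.mem_univ (i, j, l)))
      · simp [h1, h2, h3]
      · split_ifs
        · exact hpn
        · exact le_rfl
    · push Not at hf
      obtain ⟨i, hi⟩ := hf
      have h0 : ∏ m, μ (f m) = 0 :=
        Finset.prod_eq_zero (Finset.mem_univ i) (Set.indicator_of_notMem hi _)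
      simp [h0]
  have hub : ∀ i j l : Fin (n + 1), ∑ f : Fin (n + 1) → V,
        (if l ≠ i ∧ l ≠ j ∧ D (f i) (f j) (f l) then ∏ m, μ (f m) else 0) ≤ η * w ^ (n + 1) := by
    intro i j l
    by_cases h : l ≠ i ∧ l ≠ j
    · refine le_trans (le_of_eq ?_) (hbad i j l h.1 h.2)
      refine Finset.sum_congr rfl fun f _ => ?_
      simp [h.1, h.2]
    · have : ∀ f : Fin (n + 1) → V,
          (if l ≠ i ∧ l ≠ j ∧ D (f i) (f j) (f l) then ∏ m, μ (f m) else 0) = 0 := by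
        intro f
        rw [if_neg]
        rintro ⟨h1, h2, _⟩
        exact h ⟨h1, h2⟩
      simp only [this, Finset.sum_const_zero]
      positivity
  have hfin := hle.trans (Finset.sum_le_sum fun i _ => Finset.sum_le_sum fun j _ =>
    Finset.sum_le_sum fun l _ => hub i j l)
  simp only [Finset.sum_const, Finset.card_univ, Fintype.card_fin, nsmul_eq_mul] at hfin
  have hwp : 0 < w ^ (n + 1) := by positivity
  push_cast at hfin hη
  nlinarith

end GLo
namespace GLo

/-- `p 0, …, p l` is an induced path. -/
def IPath {V : Type} (G : SimpleGraph V) (p : ℕ → V) (l : ℕ) : Prop :=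
  (∀ i ≤ l, ∀ j ≤ l, p i = p j → i = j) ∧
    ∀ i ≤ l, ∀ j ≤ l, G.Adj (p i) (p j) ↔ (i + 1 = j ∨ j + 1 = i)

/-- occurrences of `s` on a path -/
def occ {V : Type} (G : SimpleGraph V) (p : ℕ → V) (l : ℕ) (s : V) : Set ℕ :=
  {i | i ≤ l ∧ G.Adj s (p i)}

theorem IPath.interval_RI {V : Type} {G : SimpleGraph V} {p : ℕ → V} {l : ℕ} (hp : IPath G p l)
    {a b : ℕ} (hb : b ≤ l + 1) {W : Set V} (hW : ∀ i, a ≤ i → i < b → p i ∈ W) :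
    ∀ i, a ≤ i → i < b → RI G W (p a) (p i) := by
  intro i hai
  induction i, hai using Nat.le_induction with
  | base => intro _; exact RI.refl
  | succ i hai ih =>
    intro hib
    refine (ih (by omega)).tail ?_ (hW _ (by omega) hib)
    exact (hp.2 i (by omega) (i + 1) (by omega)).2 (Or.inl rfl)

theorem alt_creature {V : Type} {G : SimpleGraph V} {k : ℕ} (hk : 1 ≤ k) (cf : CreatureFree G k)
    {p : ℕ → V} {l : ℕ} (hp : IPath G p l) {s s' : V} (hss : s ≠ s') (hadj : ¬ G.Adj s s')
    (hsh : ∀ i ≤ l, ¬ (G.Adj s (p i) ∧ G.Adj s' (p i))) (hs' : ∀ i ≤ l, p i ≠ s') :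
    ¬ Alt (3 * k) (occ G p l s) (occ G p l s') := by
  classical
  rintro ⟨lo, hi, hlh, hocc⟩
  have hle : ∀ h < 3 * k, lo h ≤ hi h := by
    intro h hh
    obtain ⟨⟨x, _, h1, h2⟩, _⟩ := hocc h hh
    omega
  have hsep : ∀ h h', h < h' → h' < 3 * k → hi h < lo h' := by
    intro h h' hh'
    induction h', hh' using Nat.le_induction with
    | base => exact hlh h
    | succ m hm ih =>
      intro hm'
      have h1 := ih (by omega)
      have h2 := hle m (by omega)
      have h3 := hlh m hm'
      omega
  have hex : ∀ g, g < k → ∃ x y, x < y ∧ y ≤ l ∧ G.Adj s (p x) ∧ G.Adj s' (p y) ∧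
      (∀ i, x ≤ i → i < y → ¬ G.Adj s' (p i)) ∧ lo (3 * g) ≤ x ∧ y ≤ hi (3 * g + 1) := by
    intro g hg
    obtain ⟨⟨x, ⟨hxl, hx⟩, hx1, hx2⟩, _⟩ := hocc (3 * g) (by omega)
    obtain ⟨_, ⟨z, ⟨hzl, hz⟩, hz1, hz2⟩⟩ := hocc (3 * g + 1) (by omega)
    have hlt := hsep (3 * g) (3 * g + 1) (by omega) (by omega)
    have hE : ∃ y, x ≤ y ∧ G.Adj s' (p y) := ⟨z, by omega, hz⟩
    obtain ⟨hy1, hy2⟩ := Nat.find_spec hE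
    have hyz : Nat.find hE ≤ z := Nat.find_min' hE ⟨by omega, hz⟩
    refine ⟨x, Nat.find hE, ?_, by omega, hx, hy2, ?_, hx1, by omega⟩
    · rcases Nat.eq_or_lt_of_le hy1 with h | h
      · exfalso
        rw [← h] at hy2
        exact hsh x hxl ⟨hx, hy2⟩
      · exact h
    · intro i hi1 hi2 hai
      exact Nat.find_min hE hi2 ⟨hi1, hai⟩
  choose! X Y hXY hYl hsX hsY hbet hloX hYhi using hex
  have hgap : ∀ g g', g < g' → g' < k → Y g + 2 ≤ X g' := by
    intro g g' hg hg'
    have h1 := hYhi g (by omega)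
    have h2 := hsep (3 * g + 1) (3 * g + 2) (by omega) (by omega)
    have h3 := hle (3 * g + 2) (by omega)
    have h4 := hsep (3 * g + 2) (3 * g') (by omega) (by omega)
    have h5 := hloX g' hg'
    omega
  have hcmp : ∀ g g', g < k → g' < k → ∀ i, X g' ≤ i → i < Y g' → g ≠ g' → i + 2 ≤ Y g ∧ i + 3 ≤ Y g ∨ Y g + 2 ≤ i := by
    intro g g' hg hg' i h1 h2 hne
    rcases lt_or_gt_of_ne hne with h | h
    · have := hgap g g' h hg'; omega
    · have := hgap g' g h hg
      have := hXY g hg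
      omega
  refine cf _ _ _ _ (creature_mk hk (A := {v | v = s ∨ ∃ g < k, ∃ i, X g ≤ i ∧ i + 1 < Y g ∧ v = p i})
    (B := {s'}) ?_ (singleton_connected G s') ?_ ?_ (fun g => p (Y g - 1)) (fun g => p (Y g))
    ?_ ?_ ?_ ?_ ?_)
  · refine RI.connected (r := s) (Or.inl rfl) ?_
    rintro v (rfl | ⟨g, hg, i, hi1, hi2, rfl⟩)
    · exact RI.refl
    · have h1 := hYl g hg
      have h2 := hXY g hg
      refine RI.trans (RI.tail RI.refl (hsX g hg) (Or.inr ⟨g, hg, X g, le_rfl, by omega, rfl⟩)) ?_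
      refine hp.interval_RI (a := X g) (b := Y g - 1) (by omega) ?_ i hi1 (by omega)
      intro i' hi1' hi2'
      exact Or.inr ⟨g, hg, i', hi1', by omega, rfl⟩
  · rw [Set.disjoint_singleton_right]
    rintro (h | ⟨g, hg, i, hi1, hi2, h⟩)
    · exact hss h.symm
    · have h1 := hYl g hg
      exact hs' i (by omega) h.symm
  · rintro a (rfl | ⟨g, hg, i, hi1, hi2, rfl⟩) b hb
    · rw [Set.mem_singleton_iff.1 hb]; exact hadj
    · rw [Set.mem_singleton_iff.1 hb, SimpleGraph.adj_comm]
      exact hbet g hg i hi1 (by omega)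
  · rintro a (rfl | ⟨g, hg, i, hi1, hi2, rfl⟩) g'
    · intro h
      exact hsh _ (hYl g' g'.2) ⟨h, hsY g' g'.2⟩
    · have h1 := hYl g hg
      have h2 := hYl g' g'.2
      rw [hp.2 i (by omega) _ h2]
      by_cases hne : (g' : ℕ) = g
      · rw [hne]; omega
      · have := hcmp g' g g'.2 hg i hi1 (by omega) hne
        omega
  · intro b hb g
    rw [Set.mem_singleton_iff.1 hb]
    have := hXY g g.2
    exact hbet g g.2 _ (by omega) (by omega)
  · intro g
    have h1 := hXY g g.2
    have h2 := hYl g g.2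
    by_cases h : X g + 1 = Y g
    · refine ⟨s, Or.inl rfl, ?_⟩
      have h3 : Y g - 1 = X g := by omega
      rw [h3]
      exact (hsX g g.2).symm
    · refine ⟨p (Y g - 2), Or.inr ⟨g, g.2, Y g - 2, by omega, by omega, rfl⟩, ?_⟩
      exact (hp.2 _ (by omega) _ (by omega)).2 (by omega)
  · intro g
    exact ⟨s', rfl, (hsY g g.2).symm⟩
  · intro g g'
    have h1 := hXY g g.2
    have h2 := hYl g g.2
    have h2' := hYl g' g'.2
    rw [hp.2 _ (by omega) _ h2']
    by_cases hne : (g' : ℕ) = g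
    · rw [hne]
      have : g = g' := Fin.ext hne.symm
      simp only [this, iff_true]
      rw [this] at h1
      omega
    · have := hcmp g' g g'.2 g.2 (Y g - 1) (by omega) (by omega) hne
      have hne' : g ≠ g' := fun h => hne (by rw [h])
      simp only [hne', iff_false]
      omega

/-- one side of the ladder -/
structure Side {V : Type} (G : SimpleGraph V) (k : ℕ) (d : ℕ → V) (T : ℕ → Set V) : Prop where
  conn : ∀ i < k, (G.induce (T i)).Connected
  disj : ∀ i < k, ∀ j < k, i ≠ j → Disjoint (T i) (T j)
  adj : ∀ i < k, ∀ j < k, i ≠ j → ((∃ a ∈ T i, ∃ b ∈ T j, G.Adj a b) ↔ (i + 1 = j ∨ j + 1 = i))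
  rung : ∀ i < k, ∀ j < k, ((∃ a ∈ T j, G.Adj (d i) a) ↔ i = j)

theorem Side.rev {V : Type} {G : SimpleGraph V} {k : ℕ} {d : ℕ → V} {T : ℕ → Set V}
    (h : Side G k d T) : Side G k (fun i => d (k - 1 - i)) (fun i => T (k - 1 - i)) := by
  refine ⟨fun i hi => h.conn _ (by omega), fun i hi j hj hij => h.disj _ (by omega) _ (by omega)
    (by omega), fun i hi j hj hij => ?_, fun i hi j hj => ?_⟩
  · rw [h.adj _ (by omega) _ (by omega) (by omega)]
    omega
  · rw [h.rung _ (by omega) _ (by omega)]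
    omega

theorem Side.congr {V : Type} {G : SimpleGraph V} {k : ℕ} {d d' : ℕ → V} {T : ℕ → Set V}
    (h : Side G k d T) (hd : ∀ i < k, d i = d' i) : Side G k d' T := by
  refine ⟨h.conn, h.disj, h.adj, fun i hi j hj => ?_⟩
  rw [← hd i hi]
  exact h.rung i hi j hj

theorem IPath.side {V : Type} {G : SimpleGraph V} {p : ℕ → V} {l : ℕ} (hp : IPath G p l) (k : ℕ)
    (d : ℕ → V) (e : ℕ → ℕ) (he : ∀ i j, i < j → j ≤ k → e i < e j) (hel : ∀ i ≤ k, e i ≤ l)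
    (h1 : ∀ i < k, G.Adj (d i) (p (e i)))
    (h2 : ∀ i < k, ∀ j < k, i ≠ j → ∀ x, e j ≤ x → x < e (j + 1) → ¬ G.Adj (d i) (p x)) :
    Side G k d (fun i => p '' {x | e i ≤ x ∧ x < e (i + 1)}) := by
  have hem : ∀ i j, i ≤ j → j ≤ k → e i ≤ e j := by
    intro i j hij hj
    rcases Nat.eq_or_lt_of_le hij with rfl | h
    · exact le_rfl
    · exact (he i j h hj).le
  refine ⟨?_, ?_, ?_, ?_⟩
  · intro i hi
    have h3 := he i (i + 1) (by omega) hi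
    refine RI.connected (r := p (e i)) ⟨e i, ⟨le_rfl, h3⟩, rfl⟩ ?_
    rintro _ ⟨x, ⟨hx1, hx2⟩, rfl⟩
    have := hel (i + 1) hi
    refine hp.interval_RI (a := e i) (b := e (i + 1)) (by omega) ?_ x hx1 hx2
    exact fun y hy1 hy2 => ⟨y, ⟨hy1, hy2⟩, rfl⟩
  · intro i hi j hj hij
    rw [Set.disjoint_left]
    rintro _ ⟨x, ⟨hx1, hx2⟩, rfl⟩ ⟨y, ⟨hy1, hy2⟩, hxy⟩
    have h3 := hel (i + 1) hi
    have h4 := hel (j + 1) hj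
    have := hp.1 y (by omega) x (by omega) hxy
    rcases lt_or_gt_of_ne hij with h | h
    · have := hem (i + 1) j h hj.le; omega
    · have := hem (j + 1) i h hi.le; omega
  · intro i hi j hj hij
    have h3 := hel (i + 1) hi
    have h4 := hel (j + 1) hj
    have h5 := he i (i + 1) (by omega) hi
    have h6 := he j (j + 1) (by omega) hj
    constructor
    · rintro ⟨_, ⟨x, ⟨hx1, hx2⟩, rfl⟩, _, ⟨y, ⟨hy1, hy2⟩, rfl⟩, hxy⟩
      have hxy' := (hp.2 x (by omega) y (by omega)).1 hxy
      by_contra hcon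
      rcases lt_or_gt_of_ne hij with h | h
      · have h7 := hem (i + 2) j (by omega) hj.le
        have h8 := he (i + 1) (i + 2) (by omega) (by omega)
        omega
      · have h7 := hem (j + 2) i (by omega) hi.le
        have h8 := he (j + 1) (j + 2) (by omega) (by omega)
        omega
    · rintro (rfl | rfl)
      · exact ⟨p (e (i + 1) - 1), ⟨_, ⟨by omega, by omega⟩, rfl⟩, p (e (i + 1)),
          ⟨_, ⟨le_rfl, h6⟩, rfl⟩, (hp.2 _ (by omega) _ (by omega)).2 (by omega)⟩
      · exact ⟨p (e (j + 1)), ⟨_, ⟨le_rfl, h5⟩, rfl⟩, p (e (j + 1) - 1),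
          ⟨_, ⟨by omega, by omega⟩, rfl⟩, (hp.2 _ (by omega) _ (by omega)).2 (by omega)⟩
  · intro i hi j hj
    constructor
    · rintro ⟨_, ⟨x, ⟨hx1, hx2⟩, rfl⟩, hx⟩
      by_contra hij
      exact h2 i hi j hj hij x hx1 hx2 hx
    · rintro rfl
      exact ⟨_, ⟨e i, ⟨le_rfl, he i (i + 1) (by omega) hi⟩, rfl⟩, h1 i hi⟩

theorem ladder_of_sides {V : Type} {G : SimpleGraph V} {k : ℕ} {d : ℕ → V} {T T' : ℕ → Set V}
    (h : Side G k d T) (h' : Side G k d T') {A B : Set V} (hTA : ∀ i < k, T i ⊆ A)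
    (hTB : ∀ i < k, T' i ⊆ B) (dAB : Disjoint A B) (ac : ∀ a ∈ A, ∀ b ∈ B, ¬ G.Adj a b)
    (hdA : ∀ i < k, d i ∉ A) (hdB : ∀ i < k, d i ∉ B)
    (hdd : ∀ i < k, ∀ j < k, ¬ G.Adj (d i) (d j)) : IsInducedMinor (skinnyLadder k) G := by
  have hinj : ∀ i < k, ∀ j < k, d i = d j → i = j := by
    intro i hi j hj hij
    have := (h.rung i hi i hi).2 rfl
    rw [hij] at this
    exact ((h.rung j hj i hi).1 this).symm
  let B' : Fin 3 × Fin k → Set V := fun x =>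
    if x.1 = 0 then T x.2 else if x.1 = 1 then T' x.2 else {d x.2}
  have hconn : ∀ x, (G.induce (B' x)).Connected := by
    rintro ⟨a, i⟩
    fin_cases a
    · exact h.conn i i.2
    · exact h'.conn i i.2
    · exact singleton_connected G _
  have hTT' : ∀ i < k, ∀ j < k, Disjoint (T i) (T' j) := fun i hi j hj =>
    dAB.mono (hTA i hi) (hTB j hj)
  have hTd : ∀ i < k, ∀ j < k, Disjoint (T i) {d j} := by
    intro i hi j hj
    rw [Set.disjoint_singleton_right]
    exact fun hh => hdA j hj (hTA i hi hh)
  have hTd' : ∀ i < k, ∀ j < k, Disjoint (T' i) {d j} := by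
    intro i hi j hj
    rw [Set.disjoint_singleton_right]
    exact fun hh => hdB j hj (hTB i hi hh)
  have hrung : ∀ i < k, ∀ j < k, ((∃ a ∈ T i, ∃ b ∈ ({d j} : Set V), G.Adj a b) ↔ i = j) := by
    intro i hi j hj
    rw [eq_comm, ← h.rung j hj i hi]
    simp [SimpleGraph.adj_comm]
  have hrung' : ∀ i < k, ∀ j < k, ((∃ a ∈ T' i, ∃ b ∈ ({d j} : Set V), G.Adj a b) ↔ i = j) := by
    intro i hi j hj
    rw [eq_comm, ← h'.rung j hj i hi]
    simp [SimpleGraph.adj_comm]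
  have hsw : ∀ X Y : Set V, (∃ a ∈ X, ∃ b ∈ Y, G.Adj a b) ↔ (∃ a ∈ Y, ∃ b ∈ X, G.Adj a b) := by
    intro X Y
    constructor <;> rintro ⟨a, ha, b, hb, hab⟩ <;> exact ⟨b, hb, a, ha, hab.symm⟩
  have hno : ∀ i < k, ∀ j < k, ¬ (∃ a ∈ T i, ∃ b ∈ T' j, G.Adj a b) := by
    rintro i hi j hj ⟨a, ha, b, hb, hab⟩
    exact ac a (hTA i hi ha) b (hTB j hj hb) hab
  refine ⟨B', fun x => connected_nonempty (hconn x), hconn, ?_, ?_⟩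
  · rintro ⟨a, i⟩ ⟨b, j⟩ hne
    fin_cases a <;> fin_cases b
    · exact h.disj i i.2 j j.2 fun hh => hne (by rw [Fin.ext hh])
    · exact hTT' i i.2 j j.2
    · exact hTd i i.2 j j.2
    · exact (hTT' j j.2 i i.2).symm
    · exact h'.disj i i.2 j j.2 fun hh => hne (by rw [Fin.ext hh])
    · exact hTd' i i.2 j j.2
    · exact (hTd j j.2 i i.2).symm
    · exact (hTd' j j.2 i i.2).symm
    · change Disjoint ({d i} : Set V) {d j}
      rw [Set.disjoint_singleton]
      exact fun hh => hne (by rw [Fin.ext (hinj i i.2 j j.2 hh)])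
  · rintro ⟨a, i⟩ ⟨b, j⟩ hne
    fin_cases a <;> fin_cases b
    · have hij : (i : ℕ) ≠ j := fun hh => hne (by rw [Fin.ext hh])
      refine (h.adj i i.2 j j.2 hij).trans ?_
      simp [skinnyLadder, SimpleGraph.fromRel_adj, Fin.ext_iff, hij]
    · refine iff_of_false (hno i i.2 j j.2) ?_
      simp [skinnyLadder, SimpleGraph.fromRel_adj]
    · refine (hrung i i.2 j j.2).trans ?_
      simp [skinnyLadder, SimpleGraph.fromRel_adj, Fin.ext_iff]
    · refine iff_of_false (fun hh => hno j j.2 i i.2 ((hsw _ _).1 hh)) ?_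
      simp [skinnyLadder, SimpleGraph.fromRel_adj]
    · have hij : (i : ℕ) ≠ j := fun hh => hne (by rw [Fin.ext hh])
      refine (h'.adj i i.2 j j.2 hij).trans ?_
      simp [skinnyLadder, SimpleGraph.fromRel_adj, Fin.ext_iff, hij]
    · refine (hrung' i i.2 j j.2).trans ?_
      simp [skinnyLadder, SimpleGraph.fromRel_adj, Fin.ext_iff]
    · refine ((hsw _ _).trans (hrung j j.2 i i.2)).trans ?_
      simp [skinnyLadder, SimpleGraph.fromRel_adj, Fin.ext_iff]
    · refine ((hsw _ _).trans (hrung' j j.2 i i.2)).trans ?_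
      simp [skinnyLadder, SimpleGraph.fromRel_adj, Fin.ext_iff]
    · refine iff_of_false ?_ ?_
      · rintro ⟨a, ha, b, hb, hab⟩
        have ha : a = d i := ha
        have hb : b = d j := hb
        rw [ha, hb] at hab
        exact hdd i i.2 j j.2 hab
      · simp [skinnyLadder, SimpleGraph.fromRel_adj]

end GLo
namespace GLo

theorem nocross (t : ℕ) : ∃ N : ℕ, ∀ r : ℕ → ℕ → Prop,
    (∀ c, Sel 4 N c → ¬ ∀ i j, i < j → j < 4 → r (c i) (c j)) →
    ∃ c, Sel t N c ∧ ∀ i j, i < j → j < t → ¬ r (c i) (c j) := by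
  obtain ⟨N, hN⟩ := ramsey (max 4 t)
  refine ⟨N, fun r hr => ?_⟩
  have h4 : 4 ≤ max 4 t := le_max_left _ _
  have ht : t ≤ max 4 t := le_max_right _ _
  obtain ⟨c, hc, h | h⟩ := hN r
  · exact absurd (fun i j hij hj => h i j hij (by omega))
      (hr c ⟨fun i j hij hj => hc.1 i j hij (by omega), fun i hi => hc.2 i (by omega)⟩)
  · exact ⟨c, ⟨fun i j hij hj => hc.1 i j hij (by omega), fun i hi => hc.2 i (by omega)⟩,
      fun i j hij hj => h i j hij (by omega)⟩

theorem clique_case (k : ℕ) (hk : 1 ≤ k) : ∃ m : ℕ, ∀ (V : Type) (G : SimpleGraph V),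
    CreatureFree G k → ∀ F : Set V,
    (∀ v ∈ F, ∀ x ∈ F, ∀ y ∈ F, ∀ z ∈ F, G.Adj v x → G.Adj v y → G.Adj v z →
      x = y ∨ y = z ∨ x = z) →
    ∀ s : ℕ → V, (∀ i < m, s i ∉ F) → (∀ i < m, ∀ j < m, i ≠ j → s i ≠ s j) →
    (∀ i < m, ∀ j < m, i ≠ j → ¬ G.Adj (s i) (s j)) →
    (∀ i j, i < j → j < m → ∃ v ∈ F, G.Adj v (s i) ∧ G.Adj v (s j) ∧
      ∀ l < m, l ≠ i → l ≠ j → ¬ G.Adj v (s l)) → False := by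
  obtain ⟨M3, hM3⟩ := ramsey (k + 1)
  obtain ⟨M2, hM2⟩ := nocross M3
  obtain ⟨M1, hM1⟩ := nocross M2
  refine ⟨2 + M1, fun V G cf F hF s hsF hsne hsadj hsh => ?_⟩
  have ha : ∀ j, j < M1 → ∃ v ∈ F, G.Adj v (s 0) ∧ G.Adj v (s (2 + j)) ∧
      ∀ l < 2 + M1, l ≠ 0 → l ≠ 2 + j → ¬ G.Adj v (s l) := fun j hj =>
    hsh 0 (2 + j) (by omega) (by omega)
  have hb : ∀ j, j < M1 → ∃ v ∈ F, G.Adj v (s 1) ∧ G.Adj v (s (2 + j)) ∧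
      ∀ l < 2 + M1, l ≠ 1 → l ≠ 2 + j → ¬ G.Adj v (s l) := fun j hj =>
    hsh 1 (2 + j) (by omega) (by omega)
  have : Nonempty V := ⟨s 0⟩
  choose! a haF has hat hax using ha
  choose! b hbF hbs hbt hbx using hb
  have hane : ∀ i < M1, ∀ j < M1, i ≠ j → a i ≠ a j := by
    intro i hi j hj hij h
    refine hax j hj (2 + i) (by omega) (by omega) (by omega) ?_
    rw [← h]; exact hat i hi
  have hbne : ∀ i < M1, ∀ j < M1, i ≠ j → b i ≠ b j := by
    intro i hi j hj hij h
    refine hbx j hj (2 + i) (by omega) (by omega) (by omega) ?_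
    rw [← h]; exact hbt i hi
  obtain ⟨c1, hc1, hr1⟩ := hM1 (fun i j => G.Adj (a i) (b j)) (by
    intro c hc hall
    have h0 := hc.2 0 (by omega)
    have h1 := hc.2 1 (by omega)
    have h2 := hc.2 2 (by omega)
    have h3 := hc.2 3 (by omega)
    have l1 := hc.1 1 2 (by omega) (by omega)
    have l2 := hc.1 2 3 (by omega) (by omega)
    rcases hF _ (haF _ h0) _ (hbF _ h1) _ (hbF _ h2) _ (hbF _ h3) (hall 0 1 (by omega) (by omega))
      (hall 0 2 (by omega) (by omega)) (hall 0 3 (by omega) (by omega)) with h | h | h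
    · exact hbne _ h1 _ h2 (by omega) h
    · exact hbne _ h2 _ h3 (by omega) h
    · exact hbne _ h1 _ h3 (by omega) h)
  obtain ⟨c2, hc2, hr2⟩ := hM2 (fun i j => G.Adj (b (c1 i)) (a (c1 j))) (by
    intro c hc hall
    have hc := hc.comp hc1
    have h0 := hc.2 0 (by omega)
    have h1 := hc.2 1 (by omega)
    have h2 := hc.2 2 (by omega)
    have h3 := hc.2 3 (by omega)
    have l1 := hc.1 1 2 (by omega) (by omega)
    have l2 := hc.1 2 3 (by omega) (by omega)
    rcases hF _ (hbF _ h0) _ (haF _ h1) _ (haF _ h2) _ (haF _ h3) (hall 0 1 (by omega) (by omega))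
      (hall 0 2 (by omega) (by omega)) (hall 0 3 (by omega) (by omega)) with h | h | h
    · exact hane _ h1 _ h2 (by omega) h
    · exact hane _ h2 _ h3 (by omega) h
    · exact hane _ h1 _ h3 (by omega) h)
  obtain ⟨c3, hc3, hr3⟩ := hM3 (fun i _ => G.Adj (a (c1 (c2 i))) (b (c1 (c2 i))))
  have hc23 := hc3.comp hc2
  have hcc := hc23.comp hc1
  set c : ℕ → ℕ := fun i => c1 (c2 (c3 i)) with hcdef
  have hcross : ∀ i < k + 1, ∀ j < k + 1, i ≠ j → ¬ G.Adj (a (c i)) (b (c j)) := by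
    intro i hi j hj hij
    rcases lt_or_gt_of_ne hij with h | h
    · exact hr1 _ _ (hc23.1 i j h hj) (hc23.2 j hj)
    · intro hadj
      exact hr2 _ _ (hc3.1 j i h hi) (hc3.2 i hi) hadj.symm
  have hcm : ∀ i : Fin k, c i < M1 := fun i => hcc.2 i (by omega)
  have hcne : ∀ i j : Fin k, i ≠ j → c i ≠ c j := fun i j hij h =>
    hij (Fin.ext (hcc.inj (by omega) (by omega) h))
  have h01 : s 0 ≠ s 1 := hsne 0 (by omega) 1 (by omega) (by omega)
  have h01a : ¬ G.Adj (s 0) (s 1) := hsadj 0 (by omega) 1 (by omega) (by omega)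
  have hs0b : ∀ i : Fin k, ¬ G.Adj (s 0) (b (c i)) := fun i h =>
    hbx _ (hcm i) 0 (by omega) (by omega) (by omega) h.symm
  have hs1a : ∀ i : Fin k, ¬ G.Adj (s 1) (a (c i)) := fun i h =>
    hax _ (hcm i) 1 (by omega) (by omega) (by omega) h.symm
  rcases hr3 with hr3 | hr3
  · refine cf _ _ _ _ (creature_mk hk (singleton_connected G (s 0)) (singleton_connected G (s 1))
      (by simpa using h01) ?_ (fun i => a (c i)) (fun i => b (c i)) ?_ ?_ ?_ ?_ ?_)
    · rintro _ rfl _ rfl; exact h01a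
    · rintro _ rfl i; exact hs0b i
    · rintro _ rfl i; exact hs1a i
    · exact fun i => ⟨_, rfl, has _ (hcm i)⟩
    · exact fun i => ⟨_, rfl, hbs _ (hcm i)⟩
    · intro i j
      constructor
      · intro h
        by_contra hij
        exact hcross i (by omega) j (by omega) (fun h => hij (Fin.ext h)) h
      · rintro rfl
        exact hr3 i k i.2 (by omega)
  · have hall : ∀ i j : Fin k, ¬ G.Adj (a (c i)) (b (c j)) := by
      intro i j
      by_cases hij : i = j
      · rw [hij]; exact hr3 j k j.2 (by omega)
      · exact hcross i (by omega) j (by omega) (fun h => hij (Fin.ext h))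
    refine cf _ _ _ _ (creature_mk hk (singleton_connected G (s 0))
      (B := {v | v = s 1 ∨ ∃ i : Fin k, v = b (c i)}) ?_ ?_ ?_ (fun i => a (c i))
      (fun i => s (2 + c i)) ?_ ?_ ?_ ?_ ?_)
    · refine RI.connected (r := s 1) (Or.inl rfl) ?_
      rintro v (rfl | ⟨i, rfl⟩)
      · exact RI.refl
      · exact RI.tail RI.refl (hbs _ (hcm i)).symm (Or.inr ⟨i, rfl⟩)
    · rw [Set.disjoint_singleton_left]
      rintro (h | ⟨i, h⟩)
      · exact h01 h
      · exact hsF 0 (by omega) (h ▸ hbF _ (hcm i))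
    · rintro _ rfl b (rfl | ⟨i, rfl⟩)
      · exact h01a
      · exact hs0b i
    · rintro _ rfl i
      have := hcm i
      exact hsadj 0 (by omega) _ (by omega) (by omega)
    · rintro b (rfl | ⟨i, rfl⟩) j
      · exact hs1a j
      · exact fun h => hall j i h.symm
    · exact fun i => ⟨_, rfl, has _ (hcm i)⟩
    · exact fun i => ⟨_, Or.inr ⟨i, rfl⟩, (hbt _ (hcm i)).symm⟩
    · intro i j
      constructor
      · intro h
        by_contra hij
        have h1 := hcm j
        have h2 := hcne i j hij
        exact hax _ (hcm i) (2 + c j) (by omega) (by omega) (by omega) h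
      · rintro rfl
        exact hat _ (hcm i)

/-- first occurrence -/
noncomputable def fst {V : Type} (G : SimpleGraph V) (p : ℕ → V) (l : ℕ) (s : V) : ℕ :=
  sInf (occ G p l s)

/-- good letter sequences along a path -/
def Good {V : Type} (G : SimpleGraph V) (p : ℕ → V) (l t : ℕ) (s : ℕ → V) : Prop :=
  (∀ i j, i < j → j < t → fst G p l (s i) < fst G p l (s j)) ∧
  ∀ i j, i < j → j < t → ∀ x ∈ occ G p l (s i), fst G p l (s j) ≤ x → fst G p l (s (t - 1)) < x

theorem Good.sub {V : Type} {G : SimpleGraph V} {p : ℕ → V} {l t t' : ℕ} {s : ℕ → V}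
    {c : ℕ → ℕ} (h : Good G p l t s) (hc : Sel t' t c) : Good G p l t' (fun i => s (c i)) := by
  refine ⟨fun i j hij hj => h.1 _ _ (hc.1 i j hij hj) (hc.2 j hj), fun i j hij hj x hx hjx => ?_⟩
  have h1 := h.2 _ _ (hc.1 i j hij hj) (hc.2 j hj) x hx hjx
  have h2 := hc.2 (t' - 1) (by omega)
  refine lt_of_le_of_lt ?_ h1
  rcases Nat.eq_or_lt_of_le (show c (t' - 1) ≤ t - 1 by omega) with h3 | h3
  · dsimp only; rw [h3]
  · exact (h.1 _ _ h3 (by omega)).le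

theorem good_exists (K t : ℕ) : ∃ N : ℕ, ∀ (V : Type) (G : SimpleGraph V) (p : ℕ → V) (l : ℕ)
    (s : ℕ → V), (∀ i < N, (occ G p l (s i)).Nonempty) →
    (∀ i < N, ∀ j < N, i ≠ j → ¬ Alt K (occ G p l (s i)) (occ G p l (s j))) →
    (∀ i j, i < j → j < N → fst G p l (s i) < fst G p l (s j)) →
    ∃ c, Sel t N c ∧ Good G p l t (fun i => s (c i)) := by
  obtain ⟨N, hN⟩ := lemW K t
  refine ⟨N, fun V G p l s hne halt hinc => ?_⟩
  obtain ⟨c, hc, hg⟩ := hN (fun i => fst G p l (s i)) (fun i => occ G p l (s i)) hinc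
    (fun i hi => Nat.sInf_mem (hne i hi)) halt
  exact ⟨c, hc, fun i j hij hj => hinc _ _ (hc.1 i j hij hj) (hc.2 j hj), hg⟩

theorem Good.side {V : Type} {G : SimpleGraph V} {p : ℕ → V} {l k : ℕ} {s : ℕ → V}
    (hp : IPath G p l) (h : Good G p l (k + 2) s) (hne : ∀ i < k + 2, (occ G p l (s i)).Nonempty) :
    ∃ T : ℕ → Set V, Side G k (fun i => s (i + 1)) T ∧ ∀ i < k, T i ⊆ p '' {i | i ≤ l} := by
  have hmem : ∀ i < k + 2, fst G p l (s i) ∈ occ G p l (s i) := fun i hi => Nat.sInf_mem (hne i hi)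
  have hem : ∀ i j, i ≤ j → j < k + 2 → fst G p l (s i) ≤ fst G p l (s j) := by
    intro i j hij hj
    rcases Nat.eq_or_lt_of_le hij with rfl | h'
    · exact le_rfl
    · exact (h.1 i j h' hj).le
  refine ⟨_, hp.side k (fun i => s (i + 1)) (fun i => fst G p l (s (i + 1)))
    (fun i j hij hj => h.1 _ _ (by omega) (by omega)) (fun i hi => (hmem (i + 1) (by omega)).1)
    (fun i hi => (hmem (i + 1) (by omega)).2) ?_, ?_⟩
  · intro i hi j hj hij x hx1 hx2 hadj
    have hxl := (hmem (j + 1 + 1) (by omega)).1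
    rcases lt_or_gt_of_ne hij with h' | h'
    · have h1 := h.2 (i + 1) (j + 1) (by omega) (by omega) x ⟨by omega, hadj⟩ hx1
      have h2 := hem (j + 1 + 1) (k + 2 - 1) (by omega) (by omega)
      omega
    · have h1 : fst G p l (s (i + 1)) ≤ x := Nat.sInf_le ⟨by omega, hadj⟩
      have h2 := hem (j + 1 + 1) (i + 1) (by omega) (by omega)
      omega
  · rintro i hi _ ⟨x, ⟨hx1, hx2⟩, rfl⟩
    have hxl := (hmem (i + 1 + 1) (by omega)).1
    exact ⟨x, by simp only [Set.mem_ofPred_eq]; omega, rfl⟩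

theorem mono_exists (t : ℕ) : ∃ N : ℕ, ∀ g : ℕ → ℕ, (∀ i < N, ∀ j < N, i ≠ j → g i ≠ g j) →
    ∃ c, Sel t N c ∧ ((∀ i j, i < j → j < t → g (c i) < g (c j)) ∨
      (∀ i j, i < j → j < t → g (c j) < g (c i))) := by
  obtain ⟨N, hN⟩ := ramsey t
  refine ⟨N, fun g hg => ?_⟩
  obtain ⟨c, hc, h | h⟩ := hN (fun i j => g i < g j)
  · exact ⟨c, hc, Or.inl h⟩
  · refine ⟨c, hc, Or.inr fun i j hij hj => ?_⟩
    have h1 := h i j hij hj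
    have h2 := hg _ (hc.2 i (by omega)) _ (hc.2 j hj) (hc.1 i j hij hj).ne
    omega

theorem indep_case (k : ℕ) (hk : 1 ≤ k) : ∃ N : ℕ, ∀ (V : Type) (G : SimpleGraph V),
    CreatureFree G k → ¬ IsInducedMinor (skinnyLadder k) G →
    ∀ A B : Set V, Disjoint A B → (∀ a ∈ A, ∀ b ∈ B, ¬ G.Adj a b) →
    ∀ (p : ℕ → V) (lp : ℕ), IPath G p lp → (∀ i ≤ lp, p i ∈ A) →
    ∀ (q : ℕ → V) (lq : ℕ), IPath G q lq → (∀ i ≤ lq, q i ∈ B) →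
    ∀ s : ℕ → V, (∀ i < N, s i ∉ A) → (∀ i < N, s i ∉ B) →
    (∀ i < N, (occ G p lp (s i)).Nonempty) → (∀ i < N, (occ G q lq (s i)).Nonempty) →
    (∀ i < N, ∀ j < N, i ≠ j → s i ≠ s j) →
    (∀ i < N, ∀ j < N, i ≠ j → ¬ G.Adj (s i) (s j)) →
    (∀ i < N, ∀ j < N, i ≠ j → ∀ x ≤ lp, ¬ (G.Adj (s i) (p x) ∧ G.Adj (s j) (p x))) →
    (∀ i < N, ∀ j < N, i ≠ j → ∀ x ≤ lq, ¬ (G.Adj (s i) (q x) ∧ G.Adj (s j) (q x))) → False := by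
  obtain ⟨N3, hN3⟩ := good_exists (3 * k) (k + 2)
  obtain ⟨N2, hN2⟩ := mono_exists N3
  obtain ⟨N1, hN1⟩ := good_exists (3 * k) N2
  obtain ⟨N0, hN0⟩ := mono_exists N1
  refine ⟨N0, fun V G cf nim A B dAB ac p lp hp hpA q lq hq hqB s hsA hsB hsp hsq hne hna hshp hshq
    => ?_⟩
  have haltp : ∀ i < N0, ∀ j < N0, i ≠ j → ¬ Alt (3 * k) (occ G p lp (s i)) (occ G p lp (s j)) :=
    fun i hi j hj hij => alt_creature hk cf hp (hne i hi j hj hij) (hna i hi j hj hij)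
      (hshp i hi j hj hij) (fun x hx h => hsA j hj (h ▸ hpA x hx))
  have haltq : ∀ i < N0, ∀ j < N0, i ≠ j → ¬ Alt (3 * k) (occ G q lq (s i)) (occ G q lq (s j)) :=
    fun i hi j hj hij => alt_creature hk cf hq (hne i hi j hj hij) (hna i hi j hj hij)
      (hshq i hi j hj hij) (fun x hx h => hsB j hj (h ▸ hqB x hx))
  have hfp : ∀ i < N0, ∀ j < N0, i ≠ j → fst G p lp (s i) ≠ fst G p lp (s j) := by
    intro i hi j hj hij h
    have h1 : fst G p lp (s i) ∈ occ G p lp (s i) := Nat.sInf_mem (hsp i hi)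
    have h2 : fst G p lp (s j) ∈ occ G p lp (s j) := Nat.sInf_mem (hsp j hj)
    rw [← h] at h2
    exact hshp i hi j hj hij _ h1.1 ⟨h1.2, h2.2⟩
  have hfq : ∀ i < N0, ∀ j < N0, i ≠ j → fst G q lq (s i) ≠ fst G q lq (s j) := by
    intro i hi j hj hij h
    have h1 : fst G q lq (s i) ∈ occ G q lq (s i) := Nat.sInf_mem (hsq i hi)
    have h2 : fst G q lq (s j) ∈ occ G q lq (s j) := Nat.sInf_mem (hsq j hj)
    rw [← h] at h2
    exact hshq i hi j hj hij _ h1.1 ⟨h1.2, h2.2⟩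
  -- step 1
  have step1 : ∃ c : ℕ → ℕ, (∀ i < N1, c i < N0) ∧ (∀ i < N1, ∀ j < N1, i ≠ j → c i ≠ c j) ∧
      ∀ i j, i < j → j < N1 → fst G p lp (s (c i)) < fst G p lp (s (c j)) := by
    obtain ⟨c, hc, h | h⟩ := hN0 (fun i => fst G p lp (s i)) hfp
    · exact ⟨c, hc.2, fun i hi j hj hij h' => hij (hc.inj hi hj h'), h⟩
    · refine ⟨fun i => c (N1 - 1 - i), fun i hi => hc.2 _ (by omega), fun i hi j hj hij h' => ?_,
        fun i j hij hj => h _ _ (by omega) (by omega)⟩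
      have := hc.inj (by omega) (by omega) h'
      omega
  obtain ⟨c1, hc1, hc1i, hinc1⟩ := step1
  obtain ⟨c2, hc2, hg2⟩ := hN1 V G p lp (fun i => s (c1 i)) (fun i hi => hsp _ (hc1 i hi))
    (fun i hi j hj hij => haltp _ (hc1 i hi) _ (hc1 j hj) (hc1i i hi j hj hij)) hinc1
  obtain ⟨c3, hc3, hmono⟩ := hN2 (fun i => fst G q lq (s (c1 (c2 i)))) (fun i hi j hj hij =>
    hfq _ (hc1 _ (hc2.2 i hi)) _ (hc1 _ (hc2.2 j hj)) (hc1i _ (hc2.2 i hi) _ (hc2.2 j hj)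
      (fun h => hij (hc2.inj hi hj h))))
  have hg3 := hg2.sub hc3
  set s3 : ℕ → V := fun i => s (c1 (c2 (c3 i))) with hs3
  have hb3 : ∀ i < N3, c1 (c2 (c3 i)) < N0 := fun i hi => hc1 _ (hc2.2 _ (hc3.2 i hi))
  have hi3 : ∀ i < N3, ∀ j < N3, i ≠ j → c1 (c2 (c3 i)) ≠ c1 (c2 (c3 j)) := fun i hi j hj hij =>
    hc1i _ (hc2.2 _ (hc3.2 i hi)) _ (hc2.2 _ (hc3.2 j hj))
      (fun h => hij (hc3.inj hi hj (hc2.inj (hc3.2 i hi) (hc3.2 j hj) h)))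
  -- final: common letters with both sides
  have hfinal : ∃ d : ℕ → V, ∃ T T' : ℕ → Set V, Side G k d T ∧ Side G k d T' ∧
      (∀ i < k, T i ⊆ p '' {i | i ≤ lp}) ∧ (∀ i < k, T' i ⊆ q '' {i | i ≤ lq}) ∧
      ∀ i < k, ∃ j < N0, d i = s j := by
    rcases hmono with hm | hm
    · obtain ⟨c4, hc4, hg4⟩ := hN3 V G q lq s3 (fun i hi => hsq _ (hb3 i hi))
        (fun i hi j hj hij => haltq _ (hb3 i hi) _ (hb3 j hj) (hi3 i hi j hj hij)) hm
      have hg4p := hg3.sub hc4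
      obtain ⟨T, hT, hTs⟩ := hg4p.side hp (fun i hi => hsp _ (hb3 _ (hc4.2 i hi)))
      obtain ⟨T', hT', hTs'⟩ := hg4.side hq (fun i hi => hsq _ (hb3 _ (hc4.2 i hi)))
      exact ⟨_, T, T', hT, hT', hTs, hTs', fun i hi => ⟨_, hb3 _ (hc4.2 (i + 1) (by omega)), rfl⟩⟩
    · obtain ⟨c4, hc4, hg4⟩ := hN3 V G q lq (fun i => s3 (N3 - 1 - i))
        (fun i hi => hsq _ (hb3 _ (by omega)))
        (fun i hi j hj hij => haltq _ (hb3 _ (by omega)) _ (hb3 _ (by omega))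
          (hi3 _ (by omega) _ (by omega) (by omega))) (fun i j hij hj => hm _ _ (by omega) (by omega))
      have hsel : Sel (k + 2) N3 (fun i => N3 - 1 - c4 (k + 1 - i)) := by
        refine ⟨fun i j hij hj => ?_, fun i hi => ?_⟩
        · have h1 := hc4.1 (k + 1 - j) (k + 1 - i) (by omega) (by omega)
          have h2 := hc4.2 (k + 1 - i) (by omega)
          dsimp only
          omega
        · have h2 := hc4.2 (k + 1 - i) (by omega)
          dsimp only
          omega
      have hg4p := hg3.sub hsel
      obtain ⟨T, hT, hTs⟩ := hg4p.side hp (fun i hi => hsp _ (hb3 _ (hsel.2 i hi)))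
      obtain ⟨T', hT', hTs'⟩ := hg4.side hq (fun i hi => hsq _ (hb3 _ (by
        have := hc4.2 i hi
        omega)))
      refine ⟨_, T, fun i => T' (k - 1 - i), hT, hT'.rev.congr ?_, hTs, fun i hi =>
        hTs' _ (by omega), fun i hi => ⟨_, hb3 _ (hsel.2 (i + 1) (by omega)), rfl⟩⟩
      intro i hi
      have h1 : k - 1 - i + 1 = k + 1 - (i + 1) := by omega
      simp only [h1]
  obtain ⟨d, T, T', hT, hT', hTs, hTs', hd⟩ := hfinal
  refine nim (ladder_of_sides hT hT' (A := A) (B := B) ?_ ?_ dAB ac ?_ ?_ ?_)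
  · intro i hi v hv
    obtain ⟨x, hx, rfl⟩ := hTs i hi hv
    exact hpA x hx
  · intro i hi v hv
    obtain ⟨x, hx, rfl⟩ := hTs' i hi hv
    exact hqB x hx
  · intro i hi
    obtain ⟨j, hj, h⟩ := hd i hi
    rw [h]; exact hsA j hj
  · intro i hi
    obtain ⟨j, hj, h⟩ := hd i hi
    rw [h]; exact hsB j hj
  · intro i hi j hj
    obtain ⟨i', hi', h1⟩ := hd i hi
    obtain ⟨j', hj', h2⟩ := hd j hj
    rw [h1, h2]
    by_cases h : i' = j'
    · rw [h]; exact G.irrefl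
    · exact hna i' hi' j' hj' h

end GLo
namespace GLo

theorem coreL (k : ℕ) (hk : 1 ≤ k) : ∃ ε : ℝ, 0 < ε ∧ ∀ (V : Type) [Fintype V]
    (G : SimpleGraph V), CreatureFree G k → ¬ IsInducedMinor (skinnyLadder k) G →
    ∀ A B T : Set V, (G.induce A).Connected → (G.induce B).Connected → Disjoint A B →
    (∀ a ∈ A, ∀ b ∈ B, ¬ G.Adj a b) → (∀ t ∈ T, ∃ a ∈ A, G.Adj t a) →
    (∀ t ∈ T, ∃ b ∈ B, G.Adj t b) → ∀ ν : V → ℝ, (∀ v, 0 ≤ ν v) → 0 < wt ν T →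
    ∃ v ∈ A ∪ B ∪ T, ε * wt ν T < wt ν (nb G {v} ∩ T) := by
  classical
  obtain ⟨m1, hm1⟩ := clique_case k hk
  obtain ⟨N0, hN0⟩ := indep_case k hk
  obtain ⟨L, hL⟩ := ramsey (max m1 N0)
  have hden : (0 : ℝ) < 2 * (k : ℝ) ^ 2 * (L : ℝ) ^ 3 + 1 := by positivity
  refine ⟨1 / (2 * (k : ℝ) ^ 2 * (L : ℝ) ^ 3 + 1), by positivity,
    fun V _ G cf nim A B T cA cB dAB ac tA tB ν hν hT => ?_⟩
  set ε : ℝ := 1 / (2 * (k : ℝ) ^ 2 * (L : ℝ) ^ 3 + 1) with hε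
  have hε0 : 0 < ε := by positivity
  by_contra hlow
  push Not at hlow
  obtain ⟨p, lp, hpA, hpi, hpa, hpw⟩ := lemP hk cf cA cB dAB ac tA tB ν hν
  set T1 : Set V := {t ∈ T | ∃ i ≤ lp, G.Adj t (p i)} with hT1
  obtain ⟨q, lq, hqB, hqi, hqa, hqw⟩ := lemP hk cf cB cA dAB.symm
    (fun b hb a ha h => ac a ha b hb h.symm) (T := T1) (fun t ht => tB t ht.1)
    (fun t ht => tA t ht.1) ν hν
  set T2 : Set V := {t ∈ T1 | ∃ i ≤ lq, G.Adj t (q i)} with hT2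
  have hp : IPath G p lp := ⟨hpi, hpa⟩
  have hq : IPath G q lq := ⟨hqi, hqa⟩
  have hT2T : T2 ⊆ T := fun t ht => ht.1.1
  have hk0 : (0 : ℝ) < k := by exact_mod_cast hk
  have hw2 : wt ν T ≤ (k : ℝ) ^ 2 * wt ν T2 := by
    have := mul_le_mul_of_nonneg_left hqw hk0.le
    calc wt ν T ≤ k * wt ν T1 := hpw
      _ ≤ k * (k * wt ν T2) := this
      _ = _ := by ring
  have hw2pos : 0 < wt ν T2 := by
    by_contra h
    push Not at h
    have : (k : ℝ) ^ 2 * wt ν T2 ≤ 0 := mul_nonpos_of_nonneg_of_nonpos (by positivity) h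
    linarith
  have hTA : ∀ t ∈ T, t ∉ A := fun t ht hA => by
    obtain ⟨b, hb, h⟩ := tB t ht
    exact ac t hA b hb h
  have hTB : ∀ t ∈ T, t ∉ B := fun t ht hB => by
    obtain ⟨a, ha, h⟩ := tA t ht
    exact ac a ha t hB h.symm
  set F : Set V := {v | (∃ i ≤ lp, v = p i) ∨ ∃ i ≤ lq, v = q i} with hFdef
  have hFAB : F ⊆ A ∪ B := by
    rintro v (⟨i, hi, rfl⟩ | ⟨i, hi, rfl⟩)
    · exact Or.inl (hpA i hi)
    · exact Or.inr (hqB i hi)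
  have hF : ∀ v ∈ F, ∀ x ∈ F, ∀ y ∈ F, ∀ z ∈ F, G.Adj v x → G.Adj v y → G.Adj v z →
      x = y ∨ y = z ∨ x = z := by
    have hpp : ∀ i ≤ lp, ∀ x ∈ F, G.Adj (p i) x → ∃ a ≤ lp, x = p a ∧ (i + 1 = a ∨ a + 1 = i) := by
      rintro i hi x (⟨a, ha, rfl⟩ | ⟨a, ha, rfl⟩) h
      · exact ⟨a, ha, rfl, (hpa i hi a ha).1 h⟩
      · exact absurd h (ac _ (hpA i hi) _ (hqB a ha))
    have hqq : ∀ i ≤ lq, ∀ x ∈ F, G.Adj (q i) x → ∃ a ≤ lq, x = q a ∧ (i + 1 = a ∨ a + 1 = i) := by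
      rintro i hi x (⟨a, ha, rfl⟩ | ⟨a, ha, rfl⟩) h
      · exact absurd h.symm (ac _ (hpA a ha) _ (hqB i hi))
      · exact ⟨a, ha, rfl, (hqa i hi a ha).1 h⟩
    rintro v (⟨i, hi, rfl⟩ | ⟨i, hi, rfl⟩) x hx y hy z hz h1 h2 h3
    · obtain ⟨a, _, rfl, ha⟩ := hpp i hi x hx h1
      obtain ⟨b, _, rfl, hb⟩ := hpp i hi y hy h2
      obtain ⟨c, _, rfl, hc⟩ := hpp i hi z hz h3
      have : a = b ∨ b = c ∨ a = c := by omega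
      rcases this with rfl | rfl | rfl <;> simp
    · obtain ⟨a, _, rfl, ha⟩ := hqq i hi x hx h1
      obtain ⟨b, _, rfl, hb⟩ := hqq i hi y hy h2
      obtain ⟨c, _, rfl, hc⟩ := hqq i hi z hz h3
      have : a = b ∨ b = c ∨ a = c := by omega
      rcases this with rfl | rfl | rfl <;> simp
  -- shared vertex
  have hshex : ∀ s t : V, ∃ v, ((∃ v ∈ F, G.Adj v s ∧ G.Adj v t) → v ∈ F ∧ G.Adj v s ∧ G.Adj v t) ∧
      (v ∈ F ∨ v = s) := by
    intro s t
    by_cases h : ∃ v ∈ F, G.Adj v s ∧ G.Adj v t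
    · obtain ⟨v, hv, h'⟩ := h
      exact ⟨v, fun _ => ⟨hv, h'⟩, Or.inl hv⟩
    · exact ⟨s, fun h' => absurd h' h, Or.inr rfl⟩
  choose sh hsh1 hsh2 using hshex
  obtain ⟨f, hfT, hfD⟩ := sampling ν hν T2 (fun s t r => r = s ∨ G.Adj s r ∨ G.Adj (sh s t) r)
    (2 * ε * (k : ℝ) ^ 2) L (by
      intro s hs t ht
      have hsub : {r ∈ T2 | r = s ∨ G.Adj s r ∨ G.Adj (sh s t) r} ⊆
          (nb G {s} ∩ T) ∪ (nb G {sh s t} ∩ T) := by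
        rintro r ⟨hr, h | h | h⟩
        · exact Or.inl ⟨⟨s, rfl, Or.inl h⟩, hT2T hr⟩
        · exact Or.inl ⟨⟨s, rfl, Or.inr h⟩, hT2T hr⟩
        · exact Or.inr ⟨⟨_, rfl, Or.inr h⟩, hT2T hr⟩
      have h1 := hlow s (Or.inr (hT2T hs))
      have h2 := hlow (sh s t) (by
        rcases hsh2 s t with h | h
        · exact Or.inl (hFAB h)
        · rw [h]; exact Or.inr (hT2T hs))
      have h3 := (wt_mono hν hsub).trans (wt_union_le hν _ _)
      have h4 := mul_le_mul_of_nonneg_left hw2 hε0.le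
      linarith) (by
      rw [hε]
      have : (L : ℝ) ^ 3 * (2 * (1 / (2 * (k : ℝ) ^ 2 * (L : ℝ) ^ 3 + 1)) * (k : ℝ) ^ 2) =
          (2 * (k : ℝ) ^ 2 * (L : ℝ) ^ 3) / (2 * (k : ℝ) ^ 2 * (L : ℝ) ^ 3 + 1) := by ring
      rw [this, div_lt_one hden]
      linarith) hw2pos
  obtain ⟨v0, hv0⟩ := connected_nonempty cA
  set s : ℕ → V := fun i => if h : i < L then f ⟨i, h⟩ else v0 with hs
  have hsT : ∀ i < L, s i ∈ T2 := by
    intro i hi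
    simp only [hs, hi, dite_true]
    exact hfT _
  have hsD : ∀ i < L, ∀ j < L, ∀ l < L, l ≠ i → l ≠ j →
      ¬ (s l = s i ∨ G.Adj (s i) (s l) ∨ G.Adj (sh (s i) (s j)) (s l)) := by
    intro i hi j hj l hl h1 h2
    simp only [hs, hi, hj, hl, dite_true]
    exact hfD ⟨i, hi⟩ ⟨j, hj⟩ ⟨l, hl⟩ (fun h => h1 (Fin.ext_iff.1 h)) (fun h => h2 (Fin.ext_iff.1 h))
  have hsne : ∀ i < L, ∀ j < L, i ≠ j → s i ≠ s j := fun i hi j hj hij h =>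
    hsD j hj j hj i hi hij hij (Or.inl h)
  have hsna : ∀ i < L, ∀ j < L, i ≠ j → ¬ G.Adj (s i) (s j) := fun i hi j hj hij h =>
    hsD i hi i hi j hj hij.symm hij.symm (Or.inr (Or.inl h))
  obtain ⟨c, hc, hcase⟩ := hL (fun i j => ∃ v ∈ F, G.Adj v (s i) ∧ G.Adj v (s j))
  have hm1t : m1 ≤ max m1 N0 := le_max_left _ _
  have hN0t : N0 ≤ max m1 N0 := le_max_right _ _
  have hcL : ∀ i < max m1 N0, c i < L := hc.2
  have hcne : ∀ i < max m1 N0, ∀ j < max m1 N0, i ≠ j → c i ≠ c j := fun i hi j hj hij h =>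
    hij (hc.inj hi hj h)
  rcases hcase with hcase | hcase
  · refine hm1 V G cf F hF (fun i => s (c i)) ?_ ?_ ?_ ?_
    · intro i hi hF'
      have hiT := hT2T (hsT _ (hcL i (by omega)))
      rcases hFAB hF' with h | h
      · exact hTA _ hiT h
      · exact hTB _ hiT h
    · exact fun i hi j hj hij => hsne _ (hcL i (by omega)) _ (hcL j (by omega))
        (hcne i (by omega) j (by omega) hij)
    · exact fun i hi j hj hij => hsna _ (hcL i (by omega)) _ (hcL j (by omega))
        (hcne i (by omega) j (by omega) hij)
    · intro i j hij hj
      obtain ⟨h1, h2, h3⟩ := hsh1 _ _ (hcase i j hij (by omega))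
      refine ⟨_, h1, h2, h3, fun l hl hli hlj h => ?_⟩
      exact hsD _ (hcL i (by omega)) _ (hcL j (by omega)) _ (hcL l (by omega))
        (hcne l (by omega) i (by omega) hli) (hcne l (by omega) j (by omega) hlj)
        (Or.inr (Or.inr h))
  · have hnosh : ∀ i < N0, ∀ j < N0, i ≠ j → ¬ ∃ v ∈ F, G.Adj v (s (c i)) ∧ G.Adj v (s (c j)) := by
      intro i hi j hj hij
      rcases lt_or_gt_of_ne hij with h | h
      · exact hcase i j h (by omega)
      · rintro ⟨v, hv, h1, h2⟩
        exact hcase j i h (by omega) ⟨v, hv, h2, h1⟩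
    refine hN0 V G cf nim A B dAB ac p lp hp hpA q lq hq hqB (fun i => s (c i)) ?_ ?_ ?_ ?_ ?_ ?_ ?_
      ?_
    · exact fun i hi => hTA _ (hT2T (hsT _ (hcL i (by omega))))
    · exact fun i hi => hTB _ (hT2T (hsT _ (hcL i (by omega))))
    · intro i hi
      obtain ⟨x, hx, h⟩ := (hsT _ (hcL i (by omega))).1.2
      exact ⟨x, hx, h⟩
    · intro i hi
      obtain ⟨x, hx, h⟩ := (hsT _ (hcL i (by omega))).2
      exact ⟨x, hx, h⟩
    · exact fun i hi j hj hij => hsne _ (hcL i (by omega)) _ (hcL j (by omega))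
        (hcne i (by omega) j (by omega) hij)
    · exact fun i hi j hj hij => hsna _ (hcL i (by omega)) _ (hcL j (by omega))
        (hcne i (by omega) j (by omega) hij)
    · exact fun i hi j hj hij x hx h => hnosh i hi j hj hij
        ⟨p x, Or.inl ⟨x, hx, rfl⟩, h.1.symm, h.2.symm⟩
    · exact fun i hi j hj hij x hx h => hnosh i hi j hj hij
        ⟨q x, Or.inr ⟨x, hx, rfl⟩, h.1.symm, h.2.symm⟩

theorem greedy {V : Type} [Fintype V] (G : SimpleGraph V) (ν : V → ℝ) (hν : ∀ v, 0 ≤ ν v)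
    (T U : Set V) (θ : ℝ) (hθ : 0 < θ) :
    ∃ Q : Finset V, (Q : Set V) ⊆ U ∧ Q.card * θ ≤ wt ν T ∧
      ∀ v ∈ U, wt ν ((nb G {v} ∩ T) \ nb G Q) ≤ θ := by
  classical
  obtain ⟨Q, hQ, hQm⟩ := Finset.exists_max_image
    (Finset.univ.filter fun Q : Finset V => (Q : Set V) ⊆ U ∧ Q.card * θ ≤ wt ν (T ∩ nb G Q))
    (fun Q => Q.card) ⟨∅, by simpa using wt_nonneg hν _⟩
  simp only [Finset.mem_filter, Finset.mem_univ, true_and] at hQ hQm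
  refine ⟨Q, hQ.1, hQ.2.trans (wt_mono hν Set.inter_subset_left), fun v hv => ?_⟩
  by_contra hlt
  push Not at hlt
  have hvQ : v ∉ Q := by
    intro h
    have : (nb G {v} ∩ T) \ nb G Q = ∅ := by
      rw [Set.sdiff_eq_empty]
      exact fun x hx => nb_mono (by simpa using h) hx.1
    rw [this, wt_empty] at hlt
    linarith
  have h1 := hQm (insert v Q) ⟨by
    rw [Finset.coe_insert]
    exact Set.insert_subset hv hQ.1, by
    rw [Finset.card_insert_of_notMem hvQ]
    have hd : Disjoint (T ∩ nb G Q) ((nb G {v} ∩ T) \ nb G Q) := by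
      rw [Set.disjoint_left]
      exact fun x hx hx' => hx'.2 hx.2
    have hsub : (T ∩ nb G Q) ∪ ((nb G {v} ∩ T) \ nb G Q) ⊆ T ∩ nb G (insert v Q : Finset V) := by
      rintro x (hx | hx)
      · exact ⟨hx.1, nb_mono (by simp) hx.2⟩
      · exact ⟨hx.1.2, nb_mono (by simp) hx.1.1⟩
    have h2 := wt_mono hν hsub
    rw [wt_union_disj hd] at h2
    rw [Nat.cast_add, Nat.cast_one]
    linarith [hQ.2]⟩
  rw [Finset.card_insert_of_notMem hvQ] at h1
  omega

theorem wt_eq_sum_filter {V : Type} [Fintype V] (ν : V → ℝ) (X : Set V) [DecidablePred (· ∈ X)] :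
    wt ν X = ∑ v, if v ∈ X then ν v else 0 := by
  unfold wt
  refine Finset.sum_congr rfl fun v _ => ?_
  rw [Set.indicator_apply]

theorem double_count {V : Type} [Fintype V] (G : SimpleGraph V) (ν μ : V → ℝ) (X Y : Set V) :
    wt (fun s => ν s * wt μ (nb G {s} ∩ Y)) X = wt (fun v => μ v * wt ν (nb G {v} ∩ X)) Y := by
  classical
  simp only [wt_eq_sum_filter]
  have h1 : ∀ (ν μ : V → ℝ) (X Y : Set V), (∑ v, if v ∈ X then ν v * ∑ w, (if w ∈ nb G {v} ∩ Y then μ w else 0) else 0) =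
      ∑ v, ∑ w, (if v ∈ X ∧ w ∈ Y ∧ (w = v ∨ G.Adj v w) then ν v * μ w else 0) := by
    intro ν μ X Y
    refine Finset.sum_congr rfl fun v _ => ?_
    by_cases hv : v ∈ X
    · rw [if_pos hv, Finset.mul_sum]
      refine Finset.sum_congr rfl fun w _ => ?_
      have : w ∈ nb G {v} ∩ Y ↔ w ∈ Y ∧ (w = v ∨ G.Adj v w) := by
        simp [nb, and_comm]
      simp [hv, this]
    · simp [hv]
  rw [h1, h1, Finset.sum_comm]
  refine Finset.sum_congr rfl fun v _ => Finset.sum_congr rfl fun w _ => ?_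
  have : (w ∈ X ∧ v ∈ Y ∧ (v = w ∨ G.Adj w v)) ↔ (v ∈ Y ∧ w ∈ X ∧ (w = v ∨ G.Adj v w)) := by
    rw [G.adj_comm v w, eq_comm (a := v)]
    tauto
  simp only [this, mul_comm (ν w)]

theorem wt_le_of {V : Type} [Fintype V] {f g : V → ℝ} {X : Set V} (h : ∀ v ∈ X, f v ≤ g v) :
    wt f X ≤ wt g X :=
  Finset.sum_le_sum fun v _ => Set.indicator_le_indicator' (fun hv => h v hv)

theorem wt_mul {V : Type} [Fintype V] (f : V → ℝ) (c : ℝ) (X : Set V) :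
    wt (fun v => f v * c) X = wt f X * c := by
  classical
  simp only [wt_eq_sum_filter, Finset.sum_mul]
  refine Finset.sum_congr rfl fun v _ => ?_
  split_ifs <;> simp

theorem keyL (k : ℕ) (hk : 1 ≤ k) : ∃ c0 : ℕ, ∀ (V : Type) [Fintype V]
    (G : SimpleGraph V), CreatureFree G k → ¬ IsInducedMinor (skinnyLadder k) G →
    ∀ A B S : Set V, FullPair G A B S → ∀ ν μ : V → ℝ, (∀ v, 0 ≤ ν v) → (∀ v, 0 ≤ μ v) →
    ∃ QA QB Q : Finset V, QA.card ≤ c0 ∧ QB.card ≤ c0 ∧ Q.card ≤ c0 ∧ (QA : Set V) ⊆ A ∧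
      (QB : Set V) ⊆ B ∧
      wt ν (S \ (nb G QA ∪ nb G QB ∪ nb G Q)) ≤ wt ν S / 8 ∧
      wt μ ((A ∪ B) ∩ nb G Q) ≤ wt μ (A ∪ B) / 8 := by
  classical
  obtain ⟨ε, hε, hcore⟩ := coreL k hk
  obtain ⟨c0, hc0⟩ := exists_nat_ge (2048 / ε)
  refine ⟨c0, fun V _ G cf nim A B S fp ν μ hν hμ => ?_⟩
  rcases (wt_nonneg hν S).eq_or_lt with hS0 | hS0
  · refine ⟨∅, ∅, ∅, by simp, by simp, by simp, by simp, by simp, ?_, ?_⟩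
    · have := wt_mono hν (X := S \ (nb G (∅ : Finset V) ∪ nb G (∅ : Finset V) ∪ nb G (∅ : Finset V)))
        (Y := S) Set.sdiff_subset
      linarith
    · have : (A ∪ B) ∩ nb G ((∅ : Finset V) : Set V) = ∅ := by
        ext x; simp [nb]
      rw [this, wt_empty]
      have := wt_nonneg hμ (A ∪ B)
      linarith
  set s := wt ν S with hs
  set M := wt μ (A ∪ B) with hM
  have hM0 : 0 ≤ M := wt_nonneg hμ _
  set es := ε / 16 with hes
  have hes0 : 0 < es := by positivity
  obtain ⟨Q0, hQ0s, hQ0c, hQ0⟩ := greedy G ν hν S (A ∪ B) (es / 128 * s) (by positivity)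
  set light : Set V := {v ∈ S | wt μ (nb G {v} ∩ (A ∪ B)) ≤ es / 8 * M} with hlight
  obtain ⟨Q, hQs, hQc, hQ⟩ := greedy G ν hν (S \ nb G Q0) light (es * s) (by positivity)
  have hQc' : (Q.card : ℝ) * es ≤ 1 := by
    have h1 : (Q.card : ℝ) * (es * s) ≤ s := hQc.trans (wt_mono hν Set.sdiff_subset)
    have h2 : ((Q.card : ℝ) * es) * s ≤ 1 * s := by linarith
    exact le_of_mul_le_mul_right h2 hS0
  have hQ0c' : (Q0.card : ℝ) * (es / 128) ≤ 1 := by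
    have h2 : ((Q0.card : ℝ) * (es / 128)) * s ≤ 1 * s := by linarith
    exact le_of_mul_le_mul_right h2 hS0
  have hc0' : ∀ n : ℕ, (n : ℝ) * (es / 128) ≤ 1 → n ≤ c0 := by
    intro n hn
    have h1 : (n : ℝ) ≤ 2048 / ε := by
      rw [le_div_iff₀ hε]
      rw [hes] at hn
      linarith
    exact_mod_cast h1.trans hc0
  have hQ0c0 := hc0' _ hQ0c'
  have hQc0 : Q.card ≤ c0 := by
    apply hc0'
    have : (0 : ℝ) ≤ Q.card * es := by positivity
    linarith
  refine ⟨Q0.filter (· ∈ A), Q0.filter (· ∈ B), Q, (Finset.card_filter_le _ _).trans hQ0c0,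
    (Finset.card_filter_le _ _).trans hQ0c0, hQc0, ?_, ?_, ?_, ?_⟩
  · intro v hv; simp at hv; exact hv.2
  · intro v hv; simp at hv; exact hv.2
  · by_contra hbig
    push Not at hbig
    set Srr := (S \ nb G Q0) \ nb G Q with hSrr
    have hsub : S \ (nb G (Q0.filter (· ∈ A)) ∪ nb G (Q0.filter (· ∈ B)) ∪ nb G Q) ⊆ Srr := by
      rintro v ⟨hv, hn⟩
      refine ⟨⟨hv, ?_⟩, fun h => hn (Or.inr h)⟩
      rintro ⟨x, hx, h⟩
      rcases hQ0s hx with h' | h'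
      · exact hn (Or.inl (Or.inl ⟨x, by simpa using ⟨hx, h'⟩, h⟩))
      · exact hn (Or.inl (Or.inr ⟨x, by simpa using ⟨hx, h'⟩, h⟩))
    have hbig2 : s / 8 < wt ν Srr := hbig.trans_le (wt_mono hν hsub)
    set H := Srr \ light with hH
    have hSrrS : Srr ⊆ S := fun v hv => hv.1.1
    have hHw : wt ν H ≤ s / 16 := by
      have hup : wt (fun v => μ v * wt ν (nb G {v} ∩ H)) (A ∪ B) ≤ M * (es / 128 * s) := by
        rw [hM, ← wt_mul]
        refine wt_le_of fun v hv => ?_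
        refine mul_le_mul_of_nonneg_left ?_ (hμ v)
        refine (wt_mono hν ?_).trans (hQ0 v hv)
        exact fun x hx => ⟨⟨hx.1, hSrrS hx.2.1⟩, hx.2.1.1.2⟩
      have hlo : wt ν H * (es / 8 * M) ≤ wt (fun v => ν v * wt μ (nb G {v} ∩ (A ∪ B))) H := by
        rw [← wt_mul]
        refine wt_le_of fun v hv => ?_
        refine mul_le_mul_of_nonneg_left ?_ (hν v)
        by_contra hh
        push Not at hh
        exact hv.2 ⟨hSrrS hv.1, hh.le⟩
      rw [double_count] at hlo
      rcases hM0.eq_or_lt with hM0 | hM0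
      · have : H = ∅ := by
          rw [Set.eq_empty_iff_forall_notMem]
          intro v hv
          refine hv.2 ⟨hSrrS hv.1, ?_⟩
          have := wt_mono hμ (X := nb G {v} ∩ (A ∪ B)) (Y := A ∪ B) Set.inter_subset_right
          rw [← hM0]
          linarith
        rw [this, wt_empty]
        positivity
      · have h1 := hlo.trans hup
        have hpos : 0 < es / 8 * M := by positivity
        refine le_of_mul_le_mul_right (a := es / 8 * M) ?_ hpos
        calc _ ≤ M * (es / 128 * s) := h1
          _ = _ := by ring
    set Ss := Srr ∩ light with hSs
    have hsplit : wt ν Srr ≤ wt ν Ss + wt ν H := by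
      refine (wt_mono hν ?_).trans (wt_union_le hν _ _)
      intro v hv
      by_cases h : v ∈ light
      · exact Or.inl ⟨hv, h⟩
      · exact Or.inr ⟨hv, h⟩
    have hSsw : s / 16 < wt ν Ss := by linarith
    have hSsS : Ss ⊆ S := fun v hv => hSrrS hv.1
    obtain ⟨v, hv, hvw⟩ := hcore V G cf nim A B Ss fp.cA fp.cB fp.dAB fp.ac
      (fun t ht => fp.nA t (hSsS ht)) (fun t ht => fp.nB t (hSsS ht)) ν hν (by linarith)
    have hup : wt ν (nb G {v} ∩ Ss) ≤ es * s := by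
      rcases hv with hv | hv
      · have h1 := hQ0 v hv
        have h2 : wt ν (nb G {v} ∩ Ss) ≤ wt ν ((nb G {v} ∩ S) \ nb G Q0) :=
          wt_mono hν fun x hx => ⟨⟨hx.1, hSsS hx.2⟩, hx.2.1.1.2⟩
        have h3 : 0 ≤ es * s := by positivity
        linarith
      · have h1 := hQ v hv.2
        have h2 : wt ν (nb G {v} ∩ Ss) ≤ wt ν ((nb G {v} ∩ (S \ nb G Q0)) \ nb G Q) :=
          wt_mono hν fun x hx => ⟨⟨hx.1, hx.2.1.1⟩, hx.2.1.2⟩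
        linarith
    have h4 : ε * (s / 16) < ε * wt ν Ss := mul_lt_mul_of_pos_left hSsw hε
    have h5 : es * s = ε * (s / 16) := by rw [hes]; ring
    linarith
  · have hsub : (A ∪ B) ∩ nb G Q ⊆ ⋃ x ∈ Q, nb G {x} ∩ (A ∪ B) := by
      rintro v ⟨hv, x, hx, h⟩
      simp only [Set.mem_iUnion]
      exact ⟨x, hx, ⟨x, rfl, h⟩, hv⟩
    have h1 := (wt_mono hμ hsub).trans (wt_biUnion_le hμ Q _)
    have h2 := Finset.sum_le_card_nsmul Q (fun x => wt μ (nb G {x} ∩ (A ∪ B))) (es / 8 * M)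
      (fun x hx => (hQs hx).2)
    rw [nsmul_eq_mul] at h2
    have h3 := mul_le_mul_of_nonneg_right hQc' (by positivity : 0 ≤ M / 8)
    have h4 : (Q.card : ℝ) * (es / 8 * M) = Q.card * es * (M / 8) := by ring
    linarith

end GLo
namespace GLo

open Classical in
/-- number of rounds `j < R` with `v ∈ E j` -/
noncomputable def cnt {V : Type} (E : ℕ → Set V) (R : ℕ) (v : V) : ℕ :=
  ((Finset.range R).filter (fun j => v ∈ E j)).card

theorem cnt_congr {V : Type} {E E' : ℕ → Set V} {R : ℕ} (h : ∀ j < R, E j = E' j) (v : V) :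
    cnt E R v = cnt E' R v := by
  classical
  unfold cnt
  congr 1
  ext j
  simp only [Finset.mem_filter, Finset.mem_range]
  constructor
  · rintro ⟨h1, h2⟩; exact ⟨h1, h j h1 ▸ h2⟩
  · rintro ⟨h1, h2⟩; exact ⟨h1, (h j h1).symm ▸ h2⟩

theorem cnt_succ_mem {V : Type} {E : ℕ → Set V} {R : ℕ} {v : V} (h : v ∈ E R) :
    cnt E (R + 1) v = cnt E R v + 1 := by
  unfold cnt
  rw [Finset.range_add_one, Finset.filter_insert, if_pos h, Finset.card_insert_of_notMem (by simp)]

theorem cnt_succ_notMem {V : Type} {E : ℕ → Set V} {R : ℕ} {v : V} (h : v ∉ E R) :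
    cnt E (R + 1) v = cnt E R v := by
  unfold cnt
  rw [Finset.range_add_one, Finset.filter_insert, if_neg h]

theorem pot_succ {V : Type} [Fintype V] (E : ℕ → Set V) (R : ℕ) (X : Set V) :
    wt (fun v => (2:ℝ) ^ cnt E (R + 1) v) X
      = wt (fun v => (2:ℝ) ^ cnt E R v) X + wt (fun v => (2:ℝ) ^ cnt E R v) (X ∩ E R) := by
  classical
  unfold wt
  rw [← Finset.sum_add_distrib]
  refine Finset.sum_congr rfl fun v _ => ?_
  simp only [Set.indicator_apply, Set.mem_inter_iff]
  by_cases h1 : v ∈ X <;> by_cases h2 : v ∈ E R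
  · simp only [h1, h2, cnt_succ_mem h2]; simp; ring
  · simp only [h1, h2, cnt_succ_notMem h2]; simp
  · simp [h1]
  · simp [h1]

theorem wt_pot_congr {V : Type} [Fintype V] {E E' : ℕ → Set V} {R : ℕ}
    (h : ∀ j < R, E j = E' j) (X : Set V) :
    wt (fun v => (2:ℝ) ^ cnt E R v) X = wt (fun v => (2:ℝ) ^ cnt E' R v) X := by
  congr 1
  funext v
  rw [cnt_congr h]

theorem pot_succ' {V : Type} [Fintype V] {E E' : ℕ → Set V} {R : ℕ}
    (h : ∀ j < R, E j = E' j) (X : Set V) :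
    wt (fun v => (2:ℝ) ^ cnt E (R + 1) v) X
      = wt (fun v => (2:ℝ) ^ cnt E' R v) X + wt (fun v => (2:ℝ) ^ cnt E' R v) (X ∩ E R) := by
  rw [pot_succ, wt_pot_congr h, wt_pot_congr h]

/-- failure set -/
def failS {V : Type} (G : SimpleGraph V) (QA QB Q : Finset V) : Set V :=
  (nb G QA ∪ nb G QB ∪ nb G Q)ᶜ

theorem wt_zero_pot {V : Type} [Fintype V] (E : ℕ → Set V) (X : Set V) :
    wt (fun v => (2:ℝ) ^ cnt E 0 v) X ≤ Fintype.card V := by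
  classical
  unfold wt
  calc _ ≤ ∑ _v : V, (1:ℝ) := by
        refine Finset.sum_le_sum fun v _ => ?_
        rw [Set.indicator_apply]
        split_ifs
        · simp [cnt]
        · simp
    _ = _ := by simp

theorem rounds {V : Type} [Fintype V] {G : SimpleGraph V} {A B S : Set V} {c0 : ℕ}
    (hkey : ∀ ν μ : V → ℝ, (∀ v, 0 ≤ ν v) → (∀ v, 0 ≤ μ v) → ∃ QA QB Q : Finset V,
      QA.card ≤ c0 ∧ QB.card ≤ c0 ∧ Q.card ≤ c0 ∧ (QA : Set V) ⊆ A ∧ (QB : Set V) ⊆ B ∧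
      wt ν (S \ (nb G QA ∪ nb G QB ∪ nb G Q)) ≤ wt ν S / 8 ∧
      wt μ ((A ∪ B) ∩ nb G Q) ≤ wt μ (A ∪ B) / 8) (R : ℕ) :
    ∃ QA QB Q : ℕ → Finset V, (∀ j, (QA j).card ≤ c0 ∧ (QB j).card ≤ c0 ∧ (Q j).card ≤ c0 ∧
      (QA j : Set V) ⊆ A ∧ (QB j : Set V) ⊆ B) ∧
      wt (fun v => (2:ℝ) ^ cnt (fun j => failS G (QA j) (QB j) (Q j)) R v) S
        ≤ (9/8) ^ R * Fintype.card V ∧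
      wt (fun v => (2:ℝ) ^ cnt (fun j => nb G (Q j)) R v) (A ∪ B)
        ≤ (9/8) ^ R * Fintype.card V := by
  induction R with
  | zero =>
    refine ⟨fun _ => ∅, fun _ => ∅, fun _ => ∅, by simp, ?_, ?_⟩
    · simpa using wt_zero_pot _ _
    · simpa using wt_zero_pot _ _
  | succ R ih =>
    obtain ⟨QA, QB, Q, hc, h1, h2⟩ := ih
    obtain ⟨PA, PB, P, p1, p2, p3, p4, p5, p6, p7⟩ := hkey
      (fun v => (2:ℝ) ^ cnt (fun j => failS G (QA j) (QB j) (Q j)) R v)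
      (fun v => (2:ℝ) ^ cnt (fun j => nb G (Q j)) R v) (fun v => by positivity)
      (fun v => by positivity)
    refine ⟨fun j => if j = R then PA else QA j, fun j => if j = R then PB else QB j,
      fun j => if j = R then P else Q j, ?_, ?_, ?_⟩
    · intro j
      by_cases hj : j = R
      · simp only [hj, if_true]; exact ⟨p1, p2, p3, p4, p5⟩
      · simp only [hj, if_false]; exact hc j
    · rw [pot_succ' (E' := fun j => failS G (QA j) (QB j) (Q j))]
      · simp only [if_true, failS]
        rw [← Set.sdiff_eq]
        unfold failS at p6 h1
        rw [pow_succ]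
        linarith
      · intro j hj; simp only [hj.ne, if_false]
    · rw [pot_succ' (E' := fun j => nb G (Q j))]
      · simp only [if_true]
        rw [pow_succ]
        linarith
      · intro j hj; simp only [hj.ne, if_false]

theorem cnt_lt {V : Type} [Fintype V] (E : ℕ → Set V) (r : ℕ) (X : Set V)
    (hr : Fintype.card V < 2 ^ r)
    (h : wt (fun v => (2:ℝ) ^ cnt E (4 * r) v) X ≤ (9/8) ^ (4 * r) * Fintype.card V)
    (v : V) (hv : v ∈ X) : cnt E (4 * r) v < 2 * r := by
  classical
  have h1 : (2:ℝ) ^ cnt E (4 * r) v ≤ wt (fun v => (2:ℝ) ^ cnt E (4 * r) v) X := by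
    unfold wt
    have := Finset.single_le_sum (f := fun w => X.indicator (fun v => (2:ℝ) ^ cnt E (4 * r) v) w)
      (s := Finset.univ) (fun w _ => Set.indicator_nonneg (fun _ _ => by positivity) w)
      (Finset.mem_univ v)
    rwa [Set.indicator_of_mem hv] at this
  have h2 : ((9:ℝ)/8) ^ (4 * r) ≤ 2 ^ r := by
    rw [pow_mul]
    exact pow_le_pow_left₀ (by norm_num) (by norm_num) r
  have h3 : (Fintype.card V : ℝ) < 2 ^ r := by exact_mod_cast hr
  have h4 : (2:ℝ) ^ cnt E (4 * r) v < 2 ^ (2 * r) := by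
    calc _ ≤ _ := h1.trans h
      _ ≤ 2 ^ r * (Fintype.card V : ℝ) := by gcongr
      _ < 2 ^ r * 2 ^ r := by gcongr
      _ = _ := by rw [← pow_add]; congr 1; omega
  exact (pow_lt_pow_iff_right₀ (by norm_num)).1 h4

/-- Majority set of a sequence of query sets. -/
def maj {V : Type} (G : SimpleGraph V) (r : ℕ) (Q : ℕ → Finset V) : Set V :=
  {v | 2 * r ≤ cnt (fun j => nb G (Q j)) (4 * r) v}

theorem mwu (k : ℕ) (hk : 1 ≤ k) : ∃ c0 : ℕ, ∀ (V : Type) [Fintype V] (G : SimpleGraph V),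
    CreatureFree G k → ¬ IsInducedMinor (skinnyLadder k) G → ∀ A B S, FullPair G A B S →
    ∀ r : ℕ, Fintype.card V < 2 ^ r →
    ∃ (QA QB : Finset V) (Q : ℕ → Finset V), QA.card ≤ c0 * (4 * r) ∧ QB.card ≤ c0 * (4 * r) ∧
      (∀ j, (Q j).card ≤ c0) ∧ (QA : Set V) ⊆ A ∧ (QB : Set V) ⊆ B ∧
      Disjoint (maj G r Q) (A ∪ B) ∧ S ⊆ nb G QA ∪ nb G QB ∪ maj G r Q := by
  classical
  obtain ⟨c0, h0⟩ := keyL k hk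
  refine ⟨c0, fun V _ G hc hl A B S hF r hr => ?_⟩
  obtain ⟨QA, QB, Q, hq, hS, hAB⟩ := rounds (h0 V G hc hl A B S hF) (4 * r)
  refine ⟨(Finset.range (4 * r)).biUnion QA, (Finset.range (4 * r)).biUnion QB, Q, ?_, ?_,
    fun j => (hq j).2.2.1, ?_, ?_, ?_, ?_⟩
  · have := Finset.card_biUnion_le_card_mul (Finset.range (4 * r)) QA c0 (fun j _ => (hq j).1)
    rw [Finset.card_range] at this
    rw [mul_comm c0]; exact this
  · have := Finset.card_biUnion_le_card_mul (Finset.range (4 * r)) QB c0 (fun j _ => (hq j).2.1)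
    rw [Finset.card_range] at this
    rw [mul_comm c0]; exact this
  · intro x hx
    simp only [Finset.coe_biUnion, Set.mem_iUnion] at hx
    obtain ⟨j, _, hj⟩ := hx
    exact (hq j).2.2.2.1 hj
  · intro x hx
    simp only [Finset.coe_biUnion, Set.mem_iUnion] at hx
    obtain ⟨j, _, hj⟩ := hx
    exact (hq j).2.2.2.2 hj
  · rw [Set.disjoint_left]
    intro v hv hv'
    have := cnt_lt _ r _ hr hAB v hv'
    unfold maj at hv
    simp only [Set.mem_ofPred_eq] at hv
    omega
  · intro s hs
    have h1 := cnt_lt _ r _ hr hS s hs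
    by_cases ha : s ∈ nb G ((Finset.range (4 * r)).biUnion QA : Finset V)
    · exact Or.inl (Or.inl ha)
    by_cases hb : s ∈ nb G ((Finset.range (4 * r)).biUnion QB : Finset V)
    · exact Or.inl (Or.inr hb)
    refine Or.inr ?_
    unfold maj
    simp only [Set.mem_ofPred_eq]
    have h2 : 4 * r ≤ cnt (fun j => failS G (QA j) (QB j) (Q j)) (4 * r) s
        + cnt (fun j => nb G (Q j)) (4 * r) s := by
      unfold cnt
      refine le_trans ?_ (Finset.card_union_le _ _)
      calc 4 * r = (Finset.range (4 * r)).card := by simp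
        _ ≤ _ := Finset.card_le_card ?_
      intro j hj
      rw [Finset.mem_union, Finset.mem_filter, Finset.mem_filter]
      by_cases hQ : s ∈ nb G (Q j)
      · exact Or.inr ⟨hj, hQ⟩
      · refine Or.inl ⟨hj, ?_⟩
        have e1 : s ∉ nb G (QA j) := fun h => ha (nb_mono (by
          exact_mod_cast Finset.subset_biUnion_of_mem QA hj) h)
        have e2 : s ∉ nb G (QB j) := fun h => hb (nb_mono (by
          exact_mod_cast Finset.subset_biUnion_of_mem QB hj) h)
        rintro ((h | h) | h)
        · exact e1 h
        · exact e2 h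
        · exact hQ h
    omega

end GLo
namespace GLo

/-- vertices of `U` adjacent to the blob of `X` through `Rr`. -/
def seen {V : Type} (G : SimpleGraph V) (Rr U X : Set V) : Set V :=
  {u | u ∈ U ∧ ∃ x ∈ X, ∃ v, RI G Rr x v ∧ G.Adj u v}

theorem seen_mono {V : Type} {G : SimpleGraph V} {Rr U X Y : Set V} (h : X ⊆ Y) :
    seen G Rr U X ⊆ seen G Rr U Y :=
  fun _ ⟨hu, x, hx, hv⟩ => ⟨hu, x, h hx, hv⟩

theorem mix_creature {V : Type} {G : SimpleGraph V} {k : ℕ} (hk : 1 ≤ k)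
    (hcf : CreatureFree G k) {A B S : Set V} (hF : FullPair G A B S) {Rr U : Set V}
    (hRS : ∀ v ∈ Rr, v ∉ S) {q : V} (hq : q ∈ B) (hqU : ∀ u ∈ U, ¬ G.Adj q u)
    (x u : Fin k → V) (hxB : ∀ i, x i ∈ B) (hxq : ∀ i, x i = q ∨ G.Adj q (x i))
    (hu : ∀ i, u i ∈ S ∩ U) (hux : ∀ i, ∃ v, RI G Rr (x i) v ∧ G.Adj (u i) v)
    (hpr : ∀ i j, i ≠ j → ∀ v, RI G Rr (x j) v → ¬ G.Adj (u i) v) : False := by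
  have hblob : ∀ i v, RI G Rr (x i) v → v ∈ B := by
    intro i v hv
    induction hv with
    | refl => exact hxB i
    | tail h1 h2 ih =>
      rcases hF.oB _ ih _ h2.1 with h | h
      · exact h
      · exact absurd h (hRS _ h2.2)
  set F : Set V := {b | b ∈ B ∧ ∀ i, ¬ G.Adj (u i) b} with hFdef
  have hqF : q ∈ F := ⟨hq, fun i h => hqU _ (hu i).2 h.symm⟩
  set Z := comp G F q with hZ
  have hZF : Z ⊆ F := comp_subset hqF
  have key : ∀ i v, RI G Rr (x i) v → v ∈ Z ∨
      ∃ y, RI G Rr (x i) y ∧ G.Adj (u i) y ∧ ∃ z ∈ Z, G.Adj y z := by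
    intro i v hv
    have ext : ∀ c d, c ∈ Z → G.Adj c d → RI G Rr (x i) d → d ∈ Z ∨
        ∃ y, RI G Rr (x i) y ∧ G.Adj (u i) y ∧ ∃ z ∈ Z, G.Adj y z := by
      intro c d hc hcd hd
      by_cases hdF : d ∈ F
      · exact Or.inl (RI.tail hc hcd hdF)
      · right
        have : ∃ j, G.Adj (u j) d := by
          by_contra hcon
          push Not at hcon
          exact hdF ⟨hblob i d hd, hcon⟩
        obtain ⟨j, hj⟩ := this
        have hji : j = i := by
          by_contra hne
          exact hpr j i hne d hd hj
        subst hji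
        exact ⟨d, hd, hj, c, hc, hcd.symm⟩
    induction hv with
    | refl =>
      rcases hxq i with h | h
      · left; rw [h]; exact RI.refl
      · exact ext q _ RI.refl h RI.refl
    | tail h1 h2 ih =>
      rcases ih with h | h
      · exact ext _ _ h h2.1 (RI.tail h1 h2.1 h2.2)
      · exact Or.inr h
  have hy : ∀ i, ∃ y, RI G Rr (x i) y ∧ G.Adj (u i) y ∧ ∃ z ∈ Z, G.Adj y z := by
    intro i
    obtain ⟨v, hv, hv'⟩ := hux i
    rcases key i v hv with h | h
    · exact absurd hv' ((hZF h).2 i)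
    · exact h
  choose y hy1 hy2 hy3 using hy
  refine hcf _ _ _ _ (creature_mk hk hF.cA (comp_connected (G := G) (W := F) (a := q)) ?_ ?_ u y
    ?_ ?_ ?_ hy3 ?_)
  · exact hF.dAB.mono_right fun z hz => (hZF hz).1
  · exact fun a ha b hb => hF.ac a ha b (hZF hb).1
  · exact fun a ha i => hF.ac a ha _ (hblob i _ (hy1 i))
  · exact fun b hb i h => (hZF hb).2 i h.symm
  · exact fun i => hF.nA _ (hu i).1
  · intro i j
    constructor
    · intro h
      by_contra hne
      exact hpr i j hne _ (hy1 j) h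
    · rintro rfl; exact hy2 i

theorem mix_one {V : Type} [Fintype V] {G : SimpleGraph V} {k : ℕ} (hk : 1 ≤ k)
    (hcf : CreatureFree G k) {A B S : Set V} (hF : FullPair G A B S) {Rr U : Set V}
    (hRS : ∀ v ∈ Rr, v ∉ S) {q : V} (hq : q ∈ B) (hqU : ∀ u ∈ U, ¬ G.Adj q u)
    (Wq : Set V) (hW : ∀ w ∈ Wq, w ∈ B ∧ (w = q ∨ G.Adj q w)) :
    ∃ X : Finset V, X.card ≤ k ∧ (X : Set V) ⊆ Wq ∧ seen G Rr (S ∩ U) Wq ⊆ seen G Rr (S ∩ U) X := by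
  classical
  let P : ℕ → Prop := fun m => ∃ X : Finset V, X.card = m ∧ (X : Set V) ⊆ Wq ∧
    seen G Rr (S ∩ U) Wq ⊆ seen G Rr (S ∩ U) X
  have hP : ∃ m, P m := ⟨_, Wq.toFinset, rfl, by simp, by simp⟩
  obtain ⟨X, hXc, hXW, hXs⟩ := Nat.find_spec hP
  refine ⟨X, ?_, hXW, hXs⟩
  by_contra hcon
  push Not at hcon
  have hpriv : ∀ x ∈ X, ∃ u ∈ S ∩ U, (∃ v, RI G Rr x v ∧ G.Adj u v) ∧
      ∀ x' ∈ X, x' ≠ x → ∀ v, RI G Rr x' v → ¬ G.Adj u v := by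
    intro x hx
    have hlt : (X.erase x).card < Nat.find hP := by
      rw [← hXc]; exact Finset.card_erase_lt_of_mem hx
    have hn := Nat.find_min hP hlt
    have : ¬ seen G Rr (S ∩ U) Wq ⊆ seen G Rr (S ∩ U) (X.erase x : Finset V) := by
      intro h
      exact hn ⟨_, rfl, fun w hw => hXW (Finset.erase_subset _ _ hw), h⟩
    rw [Set.not_subset] at this
    obtain ⟨u, hu1, hu2⟩ := this
    obtain ⟨hu, x', hx', v, hv1, hv2⟩ := hXs hu1
    have hno : ∀ x' ∈ X, x' ≠ x → ∀ v, RI G Rr x' v → ¬ G.Adj u v := by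
      intro x' hx' hne v hv hadj
      exact hu2 ⟨hu, x', by simpa using ⟨hx', hne⟩, v, hv, hadj⟩
    refine ⟨u, hu, ?_, hno⟩
    by_cases hxx : x' = x
    · exact ⟨v, hxx ▸ hv1, hv2⟩
    · exact absurd hv2 (hno x' hx' hxx v hv1)
  have : Nonempty V := ⟨q⟩
  choose! u hu1 hu2 hu3 using hpriv
  obtain ⟨Y, hYX, hYc⟩ := Finset.exists_subset_card_eq hcon.le
  let e := (Y.equivFinOfCardEq hYc).symm
  have he : ∀ i, (e i : V) ∈ X := fun i => hYX (e i).2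
  refine mix_creature hk hcf hF hRS hq hqU (fun i => e i) (fun i => u (e i)) ?_ ?_ ?_ ?_ ?_
  · exact fun i => (hW _ (hXW (he i))).1
  · exact fun i => (hW _ (hXW (he i))).2
  · exact fun i => hu1 _ (he i)
  · exact fun i => hu2 _ (he i)
  · intro i j hij v hv
    refine hu3 _ (he i) _ (he j) ?_ v hv
    intro h
    exact hij (e.injective (Subtype.ext h)).symm

theorem mix {V : Type} [Fintype V] {G : SimpleGraph V} {k : ℕ} (hk : 1 ≤ k)
    (hcf : CreatureFree G k) {A B S : Set V} (hF : FullPair G A B S) {Rr U W : Set V}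
    (hRS : ∀ v ∈ Rr, v ∉ S) (QB : Finset V) (hQB : (QB : Set V) ⊆ B)
    (hqU : ∀ q ∈ QB, ∀ u ∈ U, ¬ G.Adj q u) (hUB : ∀ u ∈ U, u ∉ B)
    (hBW : ∀ b ∈ B, b ∈ Rr ∨ b ∈ W) (hWQ : W ⊆ nb G QB) :
    ∃ X : Finset V, X.card ≤ k * QB.card + 1 ∧ S ∩ U = seen G Rr U X := by
  classical
  obtain ⟨b0, hb0⟩ := connected_nonempty hF.cB
  have h1 : ∀ q ∈ QB, ∃ X : Finset V, X.card ≤ k ∧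
      (X : Set V) ⊆ {w | w ∈ W ∧ w ∈ B ∧ (w = q ∨ G.Adj q w)} ∧
      seen G Rr (S ∩ U) {w | w ∈ W ∧ w ∈ B ∧ (w = q ∨ G.Adj q w)} ⊆ seen G Rr (S ∩ U) X :=
    fun q hq => mix_one hk hcf hF hRS (hQB hq) (hqU q hq) _ fun w hw => hw.2
  choose! Xq x1 x2 x3 using h1
  refine ⟨insert b0 (QB.biUnion Xq), ?_, ?_⟩
  · have := Finset.card_biUnion_le_card_mul QB Xq k x1
    have h2 := Finset.card_insert_le b0 (QB.biUnion Xq)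
    rw [mul_comm] at this
    omega
  · have hXB : ∀ x ∈ insert b0 (QB.biUnion Xq), x ∈ B := by
      intro x hx
      rw [Finset.mem_insert, Finset.mem_biUnion] at hx
      rcases hx with rfl | ⟨q, hq, hx⟩
      · exact hb0
      · exact (x2 q hq hx).2.1
    ext u
    constructor
    · rintro ⟨huS, huU⟩
      obtain ⟨b, hb, hub⟩ := hF.nB u huS
      have hr : ∃ x, (x = b0 ∨ (x ∈ W ∧ x ∈ B)) ∧ RI G Rr x b := by
        have hbr : RI G B b0 b := RI.of_connected hF.cB hb0 hb
        clear hub hb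
        induction hbr with
        | refl => exact ⟨b0, Or.inl rfl, RI.refl⟩
        | @tail c d e1 e2 ih =>
          rcases hBW d e2.2 with h | h
          · obtain ⟨x, hx, hx'⟩ := ih
            exact ⟨x, hx, RI.tail hx' e2.1 h⟩
          · exact ⟨d, Or.inr ⟨h, e2.2⟩, RI.refl⟩
      obtain ⟨x, hx, hxb⟩ := hr
      refine ⟨huU, ?_⟩
      rcases hx with rfl | ⟨hxW, hxB⟩
      · exact ⟨x, by simp, b, hxb, hub⟩
      · obtain ⟨q, hq, hxq⟩ := hWQ hxW
        obtain ⟨_, x', hx', v, hv⟩ := x3 q hq ⟨⟨huS, huU⟩, x, ⟨hxW, hxB, hxq⟩, b, hxb, hub⟩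
        refine ⟨x', ?_, v, hv⟩
        rw [Finset.mem_coe, Finset.mem_insert, Finset.mem_biUnion]
        exact Or.inr ⟨q, hq, hx'⟩
    · rintro ⟨huU, x, hx, v, hv, huv⟩
      have hvB : v ∈ B := by
        clear huv
        induction hv with
        | refl => exact hXB x hx
        | tail e1 e2 ih =>
          rcases hF.oB _ ih _ e2.1 with h | h
          · exact h
          · exact absurd h (hRS _ e2.2)
      rcases hF.oB v hvB u huv.symm with h | h
      · exact absurd h (hUB u huU)
      · exact ⟨h, huU⟩

end GLo
namespace GLo

/-- the certain part -/
def ker {V : Type} (G : SimpleGraph V) (QA QB : Finset V) (M : Set V) : Set V :=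
  M ∪ (nb G QA ∩ nb G QB)

/-- the free part -/
def rst {V : Type} (G : SimpleGraph V) (QA QB : Finset V) (M : Set V) : Set V :=
  (ker G QA QB M ∪ (nb G QA \ ker G QA QB M) ∪ (nb G QB \ ker G QA QB M))ᶜ

/-- decoding -/
def decode {V : Type} (G : SimpleGraph V) (QA QB XA XB : Finset V) (M : Set V) (a0 : V) : Set V :=
  nbhd G (comp G (ker G QA QB M ∪ seen G (rst G QA QB M) (nb G QA \ ker G QA QB M) XB ∪
    seen G (rst G QA QB M) (nb G QB \ ker G QA QB M) XA)ᶜ a0)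

theorem nb_sub {V : Type} {G : SimpleGraph V} {A B S : Set V} (hF : FullPair G A B S)
    {Q : Finset V} (hQ : (Q : Set V) ⊆ A) : nb G Q ⊆ A ∪ S := by
  rintro w ⟨q, hq, rfl | h⟩
  · exact Or.inl (hQ hq)
  · exact hF.oA q (hQ hq) w h

theorem decode_exists {V : Type} [Fintype V] {G : SimpleGraph V} {k : ℕ} (hk : 1 ≤ k)
    (hcf : CreatureFree G k) {A B S : Set V} (hF : FullPair G A B S) (QA QB : Finset V)
    (M : Set V) (hA : (QA : Set V) ⊆ A) (hB : (QB : Set V) ⊆ B) (hM : Disjoint M (A ∪ B))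
    (hS : S ⊆ nb G QA ∪ nb G QB ∪ M) :
    ∃ (XA XB : Finset V) (a0 : V), XA.card ≤ k * QA.card + 1 ∧ XB.card ≤ k * QB.card + 1 ∧
      decode G QA QB XA XB M a0 = S := by
  have nA := nb_sub hF hA
  have nB := nb_sub hF.symm hB
  have dAB := Set.disjoint_left.1 hF.dAB
  have dAS := Set.disjoint_left.1 hF.dAS
  have dBS := Set.disjoint_left.1 hF.dBS
  have hMd := Set.disjoint_left.1 hM
  have hKA : ∀ v ∈ ker G QA QB M, v ∉ A := by
    rintro v (h | ⟨_, h⟩) hv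
    · exact hMd h (Or.inl hv)
    · rcases nB h with h | h
      · exact dAB hv h
      · exact dAS hv h
  have hKB : ∀ v ∈ ker G QA QB M, v ∉ B := by
    rintro v (h | ⟨h, _⟩) hv
    · exact hMd h (Or.inr hv)
    · rcases nA h with h | h
      · exact dAB h hv
      · exact dBS hv h
  have hSc : ∀ s ∈ S, s ∈ ker G QA QB M ∪ (nb G QA \ ker G QA QB M) ∪
      (nb G QB \ ker G QA QB M) := by
    intro s hs
    by_cases hK : s ∈ ker G QA QB M
    · exact Or.inl (Or.inl hK)
    · rcases hS hs with (h | h) | h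
      · exact Or.inl (Or.inr ⟨h, hK⟩)
      · exact Or.inr ⟨h, hK⟩
      · exact absurd (Or.inl h) hK
  have hRS : ∀ v ∈ rst G QA QB M, v ∉ S := fun v hv hs => hv (hSc v hs)
  have hUB : ∀ u ∈ nb G QA \ ker G QA QB M, u ∉ B := by
    rintro u ⟨hu, _⟩ hb
    rcases nA hu with h | h
    · exact dAB h hb
    · exact dBS hb h
  have hWA : ∀ u ∈ nb G QB \ ker G QA QB M, u ∉ A := by
    rintro u ⟨hu, _⟩ hb
    rcases nB hu with h | h
    · exact dAB hb h
    · exact dAS hb h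
  obtain ⟨XB, hXB, eB⟩ := mix hk hcf hF (Rr := rst G QA QB M) (U := nb G QA \ ker G QA QB M)
    (W := nb G QB \ ker G QA QB M) hRS QB hB
    (fun q hq u hu h => hu.2 (Or.inr ⟨hu.1, q, hq, Or.inr h⟩)) hUB
    (by
      intro b hb
      by_cases h : b ∈ nb G QB \ ker G QA QB M
      · exact Or.inr h
      · left
        rintro ((h' | h') | h')
        · exact hKB _ h' hb
        · exact hUB _ h' hb
        · exact h h') Set.sdiff_subset
  obtain ⟨XA, hXA, eA⟩ := mix hk hcf hF.symm (Rr := rst G QA QB M)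
    (U := nb G QB \ ker G QA QB M)
    (W := nb G QA \ ker G QA QB M) hRS QA hA
    (fun q hq u hu h => hu.2 (Or.inr ⟨⟨q, hq, Or.inr h⟩, hu.1⟩)) hWA
    (by
      intro b hb
      by_cases h : b ∈ nb G QA \ ker G QA QB M
      · exact Or.inr h
      · left
        rintro ((h' | h') | h')
        · exact hKA _ h' hb
        · exact h h'
        · exact hWA _ h' hb) Set.sdiff_subset
  obtain ⟨a0, ha0⟩ := connected_nonempty hF.cA
  refine ⟨XA, XB, a0, hXA, hXB, ?_⟩
  unfold decode
  rw [← eA, ← eB]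
  have hc : comp G (ker G QA QB M ∪ S ∩ (nb G QA \ ker G QA QB M) ∪
      S ∩ (nb G QB \ ker G QA QB M))ᶜ a0 = A := by
    apply Set.Subset.antisymm
    · intro v hv
      change RI G _ a0 v at hv
      induction hv with
      | refl => exact ha0
      | @tail c d e1 e2 ih =>
        rcases hF.oA _ ih _ e2.1 with h | h
        · exact h
        · exfalso
          refine e2.2 ?_
          rcases hSc d h with (h' | h') | h'
          · exact Or.inl (Or.inl h')
          · exact Or.inl (Or.inr ⟨h, h'⟩)
          · exact Or.inr ⟨h, h'⟩
    · intro v hv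
      refine RI.mono ?_ (RI.of_connected hF.cA ha0 hv)
      rintro w hw ((h | h) | h)
      · exact hKA w h hw
      · exact dAS hw h.1
      · exact dAS hw h.1
  rw [hc, hF.nbhd_eq]

open Classical in
/-- finset coded by a partial function -/
noncomputable def dec {V : Type} [Fintype V] {m : ℕ} (f : Fin m → Option V) : Finset V :=
  Finset.univ.filter fun v => ∃ i, f i = some v

theorem dec_surj {V : Type} [Fintype V] {m : ℕ} (X : Finset V) (h : X.card ≤ m) :
    ∃ f : Fin m → Option V, dec f = X := by
  classical
  let e := X.equivFin
  refine ⟨fun i => if hi : (i : ℕ) < X.card then some (e.symm ⟨i, hi⟩ : V) else none, ?_⟩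
  ext v
  simp only [dec, Finset.mem_filter, Finset.mem_univ, true_and]
  constructor
  · rintro ⟨i, hi⟩
    split_ifs at hi with h'
    rw [Option.some_inj] at hi
    rw [← hi]
    exact (e.symm _).2
  · intro hv
    refine ⟨⟨e ⟨v, hv⟩, (e ⟨v, hv⟩).2.trans_le h⟩, ?_⟩
    simp

/-- sequence of finsets coded by partial functions -/
noncomputable def decQ {V : Type} [Fintype V] {R c : ℕ} (f : Fin R → Fin c → Option V) (j : ℕ) :
    Finset V := if h : j < R then dec (f ⟨j, h⟩) else ∅

theorem count (k : ℕ) (hk : 1 ≤ k) : ∃ C : ℕ, ∀ (V : Type) [Fintype V] (G : SimpleGraph V),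
    CreatureFree G k → ¬ IsInducedMinor (skinnyLadder k) G → ∀ r : ℕ, 1 ≤ r →
    Fintype.card V < 2 ^ r →
    {S : Set V | IsMinimalSeparator G S}.ncard ≤ (Fintype.card V + 1) ^ (C * r) := by
  classical
  obtain ⟨c0, h0⟩ := mwu k hk
  refine ⟨16 * k * c0 + 4 * c0 + 5, fun V _ G hcf hl r hr hn => ?_⟩
  set m := k * (c0 * (4 * r)) + 1 with hm
  let D := (Fin 4 → Fin m → Option V) × (Fin (4 * r) → Fin c0 → Option V) × V
  let dc : D → Set V := fun d =>
    decode G (dec (d.1 0)) (dec (d.1 1)) (dec (d.1 2)) (dec (d.1 3)) (maj G r (decQ d.2.1)) d.2.2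
  have hsub : {S : Set V | IsMinimalSeparator G S} ⊆ Set.range dc := by
    intro S hS
    obtain ⟨A, B, hF⟩ := FullPair.of_sep hS
    obtain ⟨QA, QB, Q, q1, q2, q3, q4, q5, q6, q7⟩ := h0 V G hcf hl A B S hF r hn
    obtain ⟨XA, XB, a0, x1, x2, x3⟩ := decode_exists hk hcf hF QA QB _ q4 q5 q6 q7
    have b1 : c0 * (4 * r) ≤ m := by nlinarith
    have b2 : k * QA.card + 1 ≤ m := by have := Nat.mul_le_mul_left k q1; omega
    have b3 : k * QB.card + 1 ≤ m := by have := Nat.mul_le_mul_left k q2; omega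
    obtain ⟨f0, e0⟩ := dec_surj QA (q1.trans b1)
    obtain ⟨f1, e1⟩ := dec_surj QB (q2.trans b1)
    obtain ⟨f2, e2⟩ := dec_surj XA (x1.trans b2)
    obtain ⟨f3, e3⟩ := dec_surj XB (x2.trans b3)
    have hq : ∀ j, ∃ f : Fin c0 → Option V, dec f = Q j := fun j => dec_surj (Q j) (q3 j)
    choose g hg using hq
    refine ⟨⟨![f0, f1, f2, f3], fun j => g j, a0⟩, ?_⟩
    have hmaj : maj G r (decQ fun j : Fin (4 * r) => g j) = maj G r Q := by
      ext v
      unfold maj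
      rw [Set.mem_ofPred_eq, Set.mem_ofPred_eq, cnt_congr (E' := fun j => nb G (Q j))]
      intro j hj
      simp only [decQ, hj, dif_pos, hg]
    change decode G (dec f0) (dec f1) (dec f2) (dec f3)
      (maj G r (decQ fun j : Fin (4 * r) => g j)) a0 = S
    rw [hmaj, e0, e1, e2, e3, x3]
  calc {S : Set V | IsMinimalSeparator G S}.ncard ≤ (Set.range dc).ncard :=
        Set.ncard_le_ncard hsub (Set.toFinite _)
    _ ≤ Fintype.card D := by
        rw [← Set.image_univ]
        refine (Set.ncard_image_le (Set.toFinite _)).trans ?_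
        rw [Set.ncard_univ, Nat.card_eq_fintype_card]
    _ = ((Fintype.card V + 1) ^ m) ^ 4 * (((Fintype.card V + 1) ^ c0) ^ (4 * r) *
          Fintype.card V) := by
        simp [D, Fintype.card_prod, Fintype.card_option]
    _ ≤ ((Fintype.card V + 1) ^ m) ^ 4 * (((Fintype.card V + 1) ^ c0) ^ (4 * r) *
          (Fintype.card V + 1) ^ 1) := by
        gcongr
        rw [pow_one]; omega
    _ = (Fintype.card V + 1) ^ (m * 4 + (c0 * (4 * r) + 1)) := by
        rw [← pow_mul, ← pow_mul, ← pow_add, ← pow_add]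
    _ ≤ _ := by
        refine Nat.pow_le_pow_right (by omega) ?_
        rw [hm]
        nlinarith

theorem final (k : ℕ) (hk : 1 ≤ k) :
    ∃ c : ℝ, 0 < c ∧ ∀ (V : Type) [Fintype V] (G : SimpleGraph V),
      CreatureFree G k → ¬ IsInducedMinor (skinnyLadder k) G →
      ({S : Set V | IsMinimalSeparator G S}.ncard : ℝ) ≤
        c * (Fintype.card V : ℝ) ^ (c * Real.log (Fintype.card V)) := by
  classical
  obtain ⟨C, hC⟩ := count k hk
  refine ⟨8 * C + 2, by positivity, fun V _ G hcf hl => ?_⟩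
  set n := Fintype.card V with hn
  rcases Nat.lt_or_ge n 2 with h | h
  · have h1 : Real.log (n : ℝ) = 0 := by
      interval_cases n <;> simp
    rw [h1, mul_zero, Real.rpow_zero, mul_one]
    have h2 : {S : Set V | IsMinimalSeparator G S}.ncard ≤ 2 := by
      calc _ ≤ (Set.univ : Set (Set V)).ncard := Set.ncard_le_ncard (Set.subset_univ _)
            (Set.toFinite _)
        _ = 2 ^ n := by rw [Set.ncard_univ, Nat.card_eq_fintype_card, Fintype.card_set]
        _ ≤ 2 ^ 1 := Nat.pow_le_pow_right (by norm_num) (by omega)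
        _ = 2 := by norm_num
    have h3 : ({S : Set V | IsMinimalSeparator G S}.ncard : ℝ) ≤ 2 := by exact_mod_cast h2
    have : (0:ℝ) ≤ C := by positivity
    linarith
  · set r := Nat.log 2 n + 1 with hr
    have h1 := hC V G hcf hl r (by omega) (Nat.lt_pow_succ_log_self (by norm_num) n)
    have hn1 : (1:ℝ) ≤ n := by exact_mod_cast (by omega : 1 ≤ n)
    have hn0 : (0:ℝ) < n := by linarith
    have h2 : (n + 1) ^ (C * r) ≤ n ^ (2 * C * r) := by
      rw [mul_assoc, pow_mul n 2]
      refine Nat.pow_le_pow_left ?_ _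
      nlinarith
    have h3 : ({S : Set V | IsMinimalSeparator G S}.ncard : ℝ) ≤ (n:ℝ) ^ (2 * C * r) := by
      exact_mod_cast h1.trans h2
    have hl2 : (1/2 : ℝ) ≤ Real.log 2 := by have := Real.log_two_gt_d9; linarith
    have hr2 : (r : ℝ) ≤ 4 * Real.log n := by
      have e1 : (2:ℕ) ^ (Nat.log 2 n) ≤ n := Nat.pow_log_le_self 2 (by omega)
      have e2 : (2:ℝ) ^ (Nat.log 2 n) ≤ n := by exact_mod_cast e1
      have e3 := Real.log_le_log (by positivity) e2
      rw [Real.log_pow] at e3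
      have e4 : Real.log 2 ≤ Real.log n := Real.log_le_log (by norm_num) (by exact_mod_cast h)
      have e5 : (0:ℝ) ≤ (Nat.log 2 n : ℝ) := by positivity
      rw [hr]; push_cast
      nlinarith
    have hlog : 0 ≤ Real.log n := Real.log_nonneg hn1
    have hC0 : (0:ℝ) ≤ C := by positivity
    have h4 : (n:ℝ) ^ (2 * C * r) ≤ (n:ℝ) ^ ((8 * C + 2 : ℝ) * Real.log n) := by
      rw [← Real.rpow_natCast]
      refine Real.rpow_le_rpow_of_exponent_le hn1 ?_
      push_cast
      nlinarith
    have h5 : 0 ≤ (n:ℝ) ^ ((8 * C + 2 : ℝ) * Real.log n) := by positivity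
    calc _ ≤ _ := h3.trans h4
      _ ≤ _ := by nlinarith

end GLo
/-- Theorem 1, Gartland–Lokshtanov: for every `k ≥ 1` there is a constant
`c_k` such that every `k`-creature-free graph on `n` vertices with no `k`-skinny-ladder induced
minor has at most `c_k · n^(c_k · log n)` minimal separators. -/
theorem creatureFree_skinnyLadderFree_minimalSeparators_quasipoly
    (k : ℕ) (hk : 1 ≤ k) :
    ∃ c : ℝ, 0 < c ∧ ∀ (V : Type) [Fintype V] (G : SimpleGraph V),
      CreatureFree G k → ¬ IsInducedMinor (skinnyLadder k) G →
      ({S : Set V | IsMinimalSeparator G S}.ncard : ℝ) ≤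
        c * (Fintype.card V : ℝ) ^ (c * Real.log (Fintype.card V)) := by
  exact GLo.final k hk
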